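/- For every ε > 0 there exists a constant c = c(ε) > 0 such that for all real numbers H ≥ 1 and D ≥ 1, the number of vectors (c₀,c₁,c₂,c₃) ∈ ℤ⁴ with c₃ ≠ 0, max{|c₀|,|c₁|,|c₂|,|c₃|} ≤ H, and 0 < |c₁²c₂² − 4c₀c₂³ − 4c₁³c₃ − 27c₀²c₃² + 18c₀c₁c₂c₃| ≤ D is at most c·H^{2/3+ε}·D^{5/6}. -/

import Mathlib

/-- Discriminant of the cubic polynomial `c₃x³ + c₂x² + c₁x + c₀`. -/
def cubicDisc (c₀ c₁ c₂ c₃ : ℤ) : ℤ :=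
  c₁ ^ 2 * c₂ ^ 2 - 4 * c₀ * c₂ ^ 3 - 4 * c₁ ^ 3 * c₃ - 27 * c₀ ^ 2 * c₃ ^ 2 +
    18 * c₀ * c₁ * c₂ * c₃



/-- Binary cubic form `a x³ + b x² y + c x y² + d y³`. -/
@[ext]
structure Cub (R : Type) where
  a : R
  b : R
  c : R
  d : R

namespace Cub

variable {R : Type} [CommRing R]

/-- substitution `x ↦ p x + q y`, `y ↦ r x + s y`. -/
def act (F : Cub R) (p q r s : R) : Cub R where
  a := F.a * p ^ 3 + F.b * p ^ 2 * r + F.c * p * r ^ 2 + F.d * r ^ 3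
  b := 3 * F.a * p ^ 2 * q + F.b * (p ^ 2 * s + 2 * p * q * r) +
    F.c * (2 * p * r * s + q * r ^ 2) + 3 * F.d * r ^ 2 * s
  c := 3 * F.a * p * q ^ 2 + F.b * (2 * p * q * s + q ^ 2 * r) +
    F.c * (p * s ^ 2 + 2 * q * r * s) + 3 * F.d * r * s ^ 2
  d := F.a * q ^ 3 + F.b * q ^ 2 * s + F.c * q * s ^ 2 + F.d * s ^ 3

def disc (F : Cub R) : R :=
  F.c ^ 2 * F.b ^ 2 - 4 * F.d * F.b ^ 3 - 4 * F.c ^ 3 * F.a - 27 * F.d ^ 2 * F.a ^ 2 +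
    18 * F.d * F.c * F.b * F.a

theorem act_act (F : Cub R) (p q r s p' q' r' s' : R) :
    (F.act p q r s).act p' q' r' s' =
      F.act (p * p' + q * r') (p * q' + q * s') (r * p' + s * r') (r * q' + s * s') := by
  ext <;> simp only [act] <;> ring

theorem act_one (F : Cub R) : F.act 1 0 0 1 = F := by
  ext <;> simp [act]

theorem act_inv (F : Cub R) (p q r s : R) (h : p * s - q * r = 1) :
    (F.act p q r s).act s (-q) (-r) p = F := by
  rw [act_act]
  have e1 : p * s + q * -r = 1 := by linear_combination h
  have e2 : p * -q + q * p = 0 := by ring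
  have e3 : r * s + s * -r = 0 := by ring
  have e4 : r * -q + s * p = 1 := by linear_combination h
  rw [e1, e2, e3, e4, act_one]

theorem disc_act (F : Cub R) (p q r s : R) :
    (F.act p q r s).disc = (p * s - q * r) ^ 6 * F.disc := by
  simp only [act, disc]; ring

def toReal (F : Cub ℤ) : Cub ℝ := ⟨F.a, F.b, F.c, F.d⟩

theorem toReal_act (F : Cub ℤ) (p q r s : ℤ) :
    (F.act p q r s).toReal = F.toReal.act p q r s := by
  ext <;> simp [act, toReal]

theorem toReal_disc (F : Cub ℤ) : F.toReal.disc = (F.disc : ℝ) := by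
  simp [disc, toReal]

/-- normal form `k (u² v + σ v³)` -/
def nf (k σ : ℝ) : Cub ℝ := ⟨0, k, 0, k * σ⟩

end Cub

open Cub

def IsDec (F : Cub ℝ) (k σ u1 u2 v1 v2 : ℝ) : Prop :=
  k ≠ 0 ∧ (σ = 1 ∨ σ = -1) ∧ u1 * v2 - u2 * v1 = 1 ∧ F = (nf k σ).act u1 u2 v1 v2

theorem IsDec.act {F : Cub ℝ} {k σ u1 u2 v1 v2 : ℝ} (h : IsDec F k σ u1 u2 v1 v2)
    {p q r s : ℝ} (hd : p * s - q * r = 1) :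
    IsDec (F.act p q r s) k σ (u1 * p + u2 * r) (u1 * q + u2 * s) (v1 * p + v2 * r)
      (v1 * q + v2 * s) := by
  obtain ⟨hk, hσ, hdet, rfl⟩ := h
  refine ⟨hk, hσ, ?_, act_act _ _ _ _ _ _ _ _ _⟩
  linear_combination hdet * (p * s - q * r) + hd

theorem IsDec.disc {F : Cub ℝ} {k σ u1 u2 v1 v2 : ℝ} (h : IsDec F k σ u1 u2 v1 v2) :
    |F.disc| = 4 * k ^ 4 := by
  obtain ⟨hk, hσ, hdet, rfl⟩ := h
  rw [disc_act, hdet]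
  have : (nf k σ).disc = - (4 * k ^ 4) * σ := by simp only [nf, Cub.disc]; ring
  rw [this, one_pow, one_mul]
  have h4 : 0 ≤ 4 * k ^ 4 := by positivity
  rcases hσ with rfl | rfl
  · rw [mul_one, abs_neg, abs_of_nonneg h4]
  · rw [mul_neg_one, neg_neg, abs_of_nonneg h4]

theorem dec0 (F : Cub ℝ) (hd : F.d = 0) (hF : F.disc ≠ 0) :
    ∃ k σ u1 u2 v1 v2, IsDec F k σ u1 u2 v1 v2 := by
  obtain ⟨a, b, c, d⟩ := F
  simp only at hd
  subst hd
  have hD : (Cub.mk a b c 0).disc = c ^ 2 * (b ^ 2 - 4 * a * c) := by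
    simp only [disc]; ring
  rw [hD] at hF
  have hc : c ≠ 0 := by rintro rfl; simp at hF
  have hb : b ^ 2 - 4 * a * c ≠ 0 := by intro h; simp [h] at hF
  set β := (4 * a * c - b ^ 2) / (4 * c) with hβ
  have hβ0 : β ≠ 0 := by
    rw [hβ]; apply div_ne_zero _ (by simpa using hc)
    intro h; apply hb; linarith
  obtain ⟨t, ht, ht4⟩ : ∃ t : ℝ, 0 < t ∧ t ^ 4 = |c / β| := by
    have hp : 0 < |c / β| := abs_pos.mpr (div_ne_zero hc hβ0)
    refine ⟨|c / β| ^ ((1 : ℝ) / 4), by positivity, ?_⟩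
    rw [← Real.rpow_natCast, ← Real.rpow_mul hp.le]; norm_num
  obtain ⟨σ, hσ, hσt⟩ : ∃ σ : ℝ, (σ = 1 ∨ σ = -1) ∧ t ^ 4 = σ * (c / β) := by
    rcases le_total 0 (c / β) with h | h
    · exact ⟨1, Or.inl rfl, by rw [ht4, abs_of_nonneg h, one_mul]⟩
    · exact ⟨-1, Or.inr rfl, by rw [ht4, abs_of_nonpos h]; ring⟩
  have hσ2 : σ * σ = 1 := by rcases hσ with rfl | rfl <;> norm_num
  have hct : c * σ / t ^ 4 = β := by
    rw [hσt]; field_simp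
    rcases hσ with rfl | rfl <;> norm_num
  have ht0 := ht.ne'
  refine ⟨c / t, σ, -(b / (2 * c)) * t, -t, 1 / t, 0, div_ne_zero hc ht0, hσ, ?_, ?_⟩
  · field_simp; ring
  · have ha : a = b ^ 2 / (4 * c) + c * σ / t ^ 4 := by
      rw [hct, hβ]; field_simp; ring
    ext
    · simp only [Cub.act, nf]
      rw [ha]; field_simp; ring
    · simp only [Cub.act, nf]; field_simp; ring
    · simp only [Cub.act, nf]; field_simp; ring
    · simp only [Cub.act, nf]; ring

theorem cubic_root (a b c d : ℝ) (ha : a ≠ 0) :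
    ∃ x : ℝ, a * x ^ 3 + b * x ^ 2 + c * x + d = 0 := by
  set B := b / a with hB
  set C := c / a with hC
  set E := d / a with hE
  set m := 1 + |B| + |C| + |E| with hm
  have hb := abs_nonneg B
  have hc := abs_nonneg C
  have he := abs_nonneg E
  have hm1 : 1 ≤ m := by linarith
  have key : |B| * m ^ 2 + |C| * m + |E| ≤ (m - 1) * m ^ 2 := by
    have h1 : |C| * m ≤ |C| * m ^ 2 := mul_le_mul_of_nonneg_left (by nlinarith) hc
    have h2 : |E| * 1 ≤ |E| * m ^ 2 := mul_le_mul_of_nonneg_left (by nlinarith) he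
    have h3 : m - 1 = |B| + |C| + |E| := by linarith
    rw [h3]; linarith
  have hm2 : 0 < m ^ 2 := by positivity
  have hB1 : |B * m ^ 2| = |B| * m ^ 2 := by rw [abs_mul, abs_of_pos hm2]
  have hC1 : |C * m| = |C| * m := by rw [abs_mul, abs_of_pos (by linarith : 0 < m)]
  have hB2 := abs_le.mp hB1.le
  have hC2 := abs_le.mp hC1.le
  have hE2 := abs_le.mp (le_refl |E|)
  have hcont : Continuous (fun x : ℝ => x ^ 3 + B * x ^ 2 + C * x + E) := by fun_prop
  have hivt := intermediate_value_Icc (by linarith : -m ≤ m) hcont.continuousOn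
  obtain ⟨x, -, hx⟩ := hivt (show (0 : ℝ) ∈ _ by
    constructor
    · nlinarith
    · nlinarith)
  refine ⟨x, ?_⟩
  simp only at hx
  have : a * x ^ 3 + b * x ^ 2 + c * x + d = a * (x ^ 3 + B * x ^ 2 + C * x + E) := by
    rw [hB, hC, hE]; field_simp
  rw [this, hx, mul_zero]

theorem exists_dec (F : Cub ℝ) (hF : F.disc ≠ 0) :
    ∃ k σ u1 u2 v1 v2, IsDec F k σ u1 u2 v1 v2 := by
  obtain ⟨p, q, r, s, hdet, h0⟩ : ∃ p q r s : ℝ, p * s - q * r = 1 ∧ (F.act p q r s).d = 0 := by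
    by_cases ha : F.a = 0
    · exact ⟨0, 1, -1, 0, by norm_num, by simp [Cub.act, ha]⟩
    · obtain ⟨x, hx⟩ := cubic_root F.a F.b F.c F.d ha
      exact ⟨1, x, 0, 1, by norm_num, by simp [Cub.act]; linarith⟩
  obtain ⟨k, σ, u1, u2, v1, v2, h⟩ := dec0 (F.act p q r s) h0 (by
    rw [disc_act, hdet]; simpa using hF)
  have := h.act (p := s) (q := -q) (r := -r) (s := p) (by linarith)
  rw [act_inv F p q r s hdet] at this
  exact ⟨_, _, _, _, _, _, this⟩

theorem reduction (u1 u2 v1 v2 : ℝ) (h : u1 * v2 - u2 * v1 = 1) :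
    ∃ p q r s : ℤ, p * s - q * r = 1 ∧
      (u1 * p + u2 * r) ^ 2 + (v1 * p + v2 * r) ^ 2 ≤
        (u1 * q + u2 * s) ^ 2 + (v1 * q + v2 * s) ^ 2 ∧
      2 * |(u1 * p + u2 * r) * (u1 * q + u2 * s) + (v1 * p + v2 * r) * (v1 * q + v2 * s)| ≤
        (u1 * p + u2 * r) ^ 2 + (v1 * p + v2 * r) ^ 2 := by
  set w1 : ℂ := ⟨u1, v1⟩
  set w2 : ℂ := ⟨u2, v2⟩
  have hn1 : 0 < u1 * u1 + v1 * v1 := by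
    by_contra hcon
    have h1 : u1 = 0 := by nlinarith [mul_self_nonneg u1, mul_self_nonneg v1]
    have h2 : v1 = 0 := by nlinarith [mul_self_nonneg u1, mul_self_nonneg v1]
    simp [h1, h2] at h
  have hw1 : w1 ≠ 0 := by
    intro h0
    have a1 := congrArg Complex.re h0
    have a2 := congrArg Complex.im h0
    simp [w1] at a1 a2
    simp [a1, a2] at h
  have him : 0 < (w2 / w1).im := by
    rw [Complex.div_im]
    simp only [w1, w2, Complex.normSq_mk]
    rw [← sub_div]
    apply div_pos _ hn1
    linarith
  obtain ⟨g, hg1, hg2⟩ := ModularGroup.exists_smul_mem_fd ⟨w2 / w1, him⟩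
  have hdet := Matrix.det_fin_two g.1
  rw [g.2] at hdet
  set e1 : ℂ := (g.1 1 0 : ℂ) * w2 + (g.1 1 1 : ℂ) * w1 with he1
  set e2 : ℂ := (g.1 0 0 : ℂ) * w2 + (g.1 0 1 : ℂ) * w1 with he2
  have hgz : ((g • (⟨w2 / w1, him⟩ : UpperHalfPlane) : UpperHalfPlane) : ℂ) = e2 / e1 := by
    rw [UpperHalfPlane.specialLinearGroup_apply]
    simp only [he1, he2]
    simp
    field_simp
  have hpos : 0 < Complex.normSq e1 := by
    rw [Complex.normSq_pos]
    intro h0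
    rw [hgz, h0] at hg1
    simp at hg1
    linarith
  rw [hgz, Complex.normSq_div, le_div_iff₀ hpos, one_mul] at hg1
  have hre : (g • (⟨w2 / w1, him⟩ : UpperHalfPlane) : UpperHalfPlane).re = (e2 / e1).re := by
    rw [← hgz]; rfl
  rw [hre, Complex.div_re, ← add_div, abs_div, abs_of_pos hpos, div_le_iff₀ hpos] at hg2
  refine ⟨g.1 1 1, g.1 0 1, g.1 1 0, g.1 0 0, by linarith, ?_, ?_⟩
  · simp [he1, he2, Complex.normSq_apply, w1, w2] at hg1
    nlinarith [hg1]
  · simp [he1, he2, Complex.normSq_apply, w1, w2] at hg2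
    have hh := hg2
    rw [show (u1 * (g.1 1 1 : ℝ) + u2 * (g.1 1 0 : ℝ)) * (u1 * (g.1 0 1 : ℝ) + u2 * (g.1 0 0 : ℝ)) + (v1 * (g.1 1 1 : ℝ) + v2 * (g.1 1 0 : ℝ)) * (v1 * (g.1 0 1 : ℝ) + v2 * (g.1 0 0 : ℝ)) = ((g.1 0 0 : ℝ) * u2 + (g.1 0 1 : ℝ) * u1) * ((g.1 1 0 : ℝ) * u2 + (g.1 1 1 : ℝ) * u1) +
        ((g.1 0 0 : ℝ) * v2 + (g.1 0 1 : ℝ) * v1) * ((g.1 1 0 : ℝ) * v2 + (g.1 1 1 : ℝ) * v1) by ring]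
    nlinarith [hh]


theorem chart_card (u1 u2 v1 v2 : ℝ) (hdet : |u1 * v2 - u2 * v1| = 1) (M ρ t0 : ℝ) (hρ : 0 ≤ ρ)
    (S : Finset (ℤ × ℤ))
    (hS : ∀ w ∈ S, IsCoprime w.1 w.2 ∧ 0 < u1 * w.1 + u2 * w.2 ∧ u1 * w.1 + u2 * w.2 ≤ M ∧
      |v1 * w.1 + v2 * w.2 - t0 * (u1 * w.1 + u2 * w.2)| ≤ ρ * (u1 * w.1 + u2 * w.2)) :
    (S.card : ℝ) ≤ 1 + 2 * ρ * M ^ 2 := by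
  classical
  let X : ℤ × ℤ → ℝ := fun w => u1 * w.1 + u2 * w.2
  let Y : ℤ × ℤ → ℝ := fun w => v1 * w.1 + v2 * w.2
  let φ : ℤ × ℤ → ℤ := fun w => ⌊(Y w / X w - t0 + ρ) * M ^ 2⌋
  have hmaps : ∀ w ∈ S, φ w ∈ Finset.Icc (0 : ℤ) ⌊2 * ρ * M ^ 2⌋ := by
    intro w hw
    obtain ⟨-, hX, hXM, hY⟩ := hS w hw
    change 0 < X w at hX
    change X w ≤ M at hXM
    change |Y w - t0 * X w| ≤ ρ * X w at hY
    have h1 : |Y w / X w - t0| ≤ ρ := by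
      rw [show Y w / X w - t0 = (Y w - t0 * X w) / X w by field_simp, abs_div, abs_of_pos hX,
        div_le_iff₀ hX]
      exact hY
    rw [abs_le] at h1
    rw [Finset.mem_Icc]
    constructor
    · apply Int.floor_nonneg.mpr
      apply mul_nonneg _ (sq_nonneg _)
      linarith
    · apply Int.floor_le_floor
      apply mul_le_mul_of_nonneg_right _ (sq_nonneg _)
      linarith
  have hinj : Set.InjOn φ S := by
    intro w hw w' hw' heq
    by_contra hne
    obtain ⟨hc, hX, hXM, -⟩ := hS w hw
    obtain ⟨hc', hX', hXM', -⟩ := hS w' hw'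
    change 0 < X w at hX
    change X w ≤ M at hXM
    change 0 < X w' at hX'
    change X w' ≤ M at hXM'
    have hcross : X w * Y w' - X w' * Y w =
        (u1 * v2 - u2 * v1) * ((w.1 * w'.2 - w.2 * w'.1 : ℤ) : ℝ) := by
      simp only [X, Y]; push_cast; ring
    have hne0 : w.1 * w'.2 - w.2 * w'.1 ≠ 0 := by
      intro h0
      have h1 : w.1 * w'.2 = w.2 * w'.1 := by linarith
      have d1 : w.1 ∣ w'.1 := hc.dvd_of_dvd_mul_left ⟨w'.2, h1.symm⟩
      have d2 : w.2 ∣ w'.2 := hc.symm.dvd_of_dvd_mul_left ⟨w'.1, h1⟩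
      obtain ⟨m, hm⟩ : ∃ m : ℤ, w'.1 = m * w.1 ∧ w'.2 = m * w.2 := by
        obtain ⟨x, y, hxy⟩ := hc
        refine ⟨x * w'.1 + y * w'.2, ?_, ?_⟩
        · linear_combination (-w'.1) * hxy - y * h1
        · linear_combination (-w'.2) * hxy + x * h1
      have hmu : IsUnit m := by
        rw [hm.1, hm.2] at hc'
        obtain ⟨x, y, hxy⟩ := hc'
        exact IsUnit.of_mul_eq_one (x * w.1 + y * w.2) (by linear_combination hxy)
      have hXX : X w' = m * X w := by
        simp only [X]; rw [hm.1, hm.2]; push_cast; ring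
      rcases Int.isUnit_iff.mp hmu with h | h
      · apply hne
        subst h
        ext <;> simp [hm.1, hm.2]
      · rw [h] at hXX
        push_cast at hXX
        linarith
    have h1 : (1 : ℝ) ≤ |X w * Y w' - X w' * Y w| := by
      rw [hcross, abs_mul, hdet, one_mul]
      exact_mod_cast Int.one_le_abs hne0
    have hM : 0 < M := lt_of_lt_of_le hX hXM
    have h2 : 1 ≤ |Y w' / X w' - Y w / X w| * M ^ 2 := by
      have : Y w' / X w' - Y w / X w = (X w * Y w' - X w' * Y w) / (X w * X w') := by
        field_simp
      rw [this, abs_div, abs_of_pos (mul_pos hX hX'), div_mul_eq_mul_div,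
        le_div_iff₀ (mul_pos hX hX'), one_mul]
      have : X w * X w' ≤ M ^ 2 := by nlinarith
      nlinarith [sq_nonneg M]
    have h3 := Int.abs_sub_lt_one_of_floor_eq_floor heq
    rw [show (Y w / X w - t0 + ρ) * M ^ 2 - (Y w' / X w' - t0 + ρ) * M ^ 2 =
      -((Y w' / X w' - Y w / X w) * M ^ 2) by ring, abs_neg, abs_mul,
      abs_of_nonneg (sq_nonneg M)] at h3
    linarith
  have hcard := Finset.card_le_card_of_injOn φ hmaps hinj
  rw [Int.card_Icc] at hcard
  have h0 : 0 ≤ 2 * ρ * M ^ 2 := by positivity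
  have hf : 0 ≤ ⌊2 * ρ * M ^ 2⌋ := Int.floor_nonneg.mpr h0
  have h4 : (S.card : ℤ) ≤ ⌊2 * ρ * M ^ 2⌋ + 1 := by omega
  have h5 : (S.card : ℝ) ≤ (⌊2 * ρ * M ^ 2⌋ : ℝ) + 1 := by exact_mod_cast h4
  linarith [Int.floor_le (2 * ρ * M ^ 2)]

theorem slope_A (σ u v M ρ : ℝ) (hσ : σ = 1 ∨ σ = -1) (hM : 0 < M) (hρ : 0 ≤ ρ)
    (hm : 1 ≤ ρ ∨ M / 2 < u) (hu : 0 < u) (hv : |v| ≤ u)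
    (hf : 1 ≤ ρ ∨ |v * (u ^ 2 + σ * v ^ 2)| ≤ ρ * M ^ 3 / 8) :
    ∃ t ∈ ({0, 1, -1} : Finset ℝ), |v - t * u| ≤ 2 * ρ * u := by
  by_cases h1 : 1 ≤ ρ
  · refine ⟨0, by simp, ?_⟩
    rw [zero_mul, sub_zero]; nlinarith
  have hm := hm.resolve_left h1
  have hf := hf.resolve_left h1
  have hM3 : ρ * M ^ 3 / 8 ≤ ρ * u ^ 3 := by
    have : (M / 2) ^ 3 ≤ u ^ 3 := by gcongr
    nlinarith
  have hf2 := hf.trans hM3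
  rw [abs_mul] at hf2
  have hv2 := abs_le.mp hv
  rcases hσ with rfl | rfl
  · refine ⟨0, by simp, ?_⟩
    rw [zero_mul, sub_zero]
    rw [abs_of_nonneg (by positivity : 0 ≤ u ^ 2 + 1 * v ^ 2)] at hf2
    have h3 : |v| * u ^ 2 ≤ (ρ * u) * u ^ 2 := by nlinarith [abs_nonneg v, sq_nonneg v, mul_nonneg (abs_nonneg v) (sq_nonneg v)]
    have := le_of_mul_le_mul_right h3 (by positivity)
    nlinarith
  · have e : u ^ 2 + -1 * v ^ 2 = (u - v) * (u + v) := by ring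
    rw [e, abs_mul, abs_of_nonneg (by linarith : 0 ≤ u - v),
      abs_of_nonneg (by linarith : 0 ≤ u + v)] at hf2
    by_cases hc : |v| ≤ u / 2
    · refine ⟨0, by simp, ?_⟩
      rw [zero_mul, sub_zero]
      have hc2 := abs_le.mp hc
      have h3 : |v| * (3 / 4 * u ^ 2) ≤ |v| * ((u - v) * (u + v)) := by
        apply mul_le_mul_of_nonneg_left _ (abs_nonneg v)
        nlinarith
      have h4 : (3 / 4 * |v|) * u ^ 2 ≤ (ρ * u) * u ^ 2 := by nlinarith
      have := le_of_mul_le_mul_right h4 (by positivity)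
      nlinarith [mul_nonneg hρ hu.le]
    · push Not at hc
      rcases le_total 0 v with hs | hs
      · refine ⟨1, by simp, ?_⟩
        rw [abs_of_nonneg hs] at hc hf2
        rw [one_mul, abs_sub_comm, abs_of_nonneg (by linarith)]
        have h3 : (u - v) * (3 / 4 * u ^ 2) ≤ (u - v) * (v * (u + v)) := by
          apply mul_le_mul_of_nonneg_left _ (by linarith)
          nlinarith
        have h4 : (3 / 4 * (u - v)) * u ^ 2 ≤ (ρ * u) * u ^ 2 := by nlinarith
        have := le_of_mul_le_mul_right h4 (by positivity)
        nlinarith [mul_nonneg hρ hu.le]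
      · refine ⟨-1, by simp, ?_⟩
        rw [abs_of_nonpos hs] at hc hf2
        rw [show v - -1 * u = u + v by ring, abs_of_nonneg (by linarith)]
        have h3 : (u + v) * (3 / 4 * u ^ 2) ≤ (u + v) * (-v * (u - v)) := by
          apply mul_le_mul_of_nonneg_left _ (by linarith)
          nlinarith
        have h4 : (3 / 4 * (u + v)) * u ^ 2 ≤ (ρ * u) * u ^ 2 := by nlinarith
        have := le_of_mul_le_mul_right h4 (by positivity)
        nlinarith [mul_nonneg hρ hu.le]

theorem slope_B (σ u v M ρ : ℝ) (hσ : σ = 1 ∨ σ = -1) (hM : 0 < M) (hρ : 0 ≤ ρ)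
    (hm : 1 ≤ ρ ∨ M / 2 < v) (hv : 0 < v) (hu : |u| ≤ v)
    (hf : 1 ≤ ρ ∨ |v * (u ^ 2 + σ * v ^ 2)| ≤ ρ * M ^ 3 / 8) :
    ∃ t ∈ ({0, 1, -1} : Finset ℝ), |u - t * v| ≤ 2 * ρ * v := by
  by_cases h1 : 1 ≤ ρ
  · refine ⟨0, by simp, ?_⟩
    rw [zero_mul, sub_zero]; nlinarith
  have hm := hm.resolve_left h1
  have hf := hf.resolve_left h1
  push Not at h1
  have hM3 : ρ * M ^ 3 / 8 ≤ ρ * v ^ 3 := by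
    have : (M / 2) ^ 3 ≤ v ^ 3 := by gcongr
    nlinarith
  have hf2 := hf.trans hM3
  rw [abs_mul, abs_of_pos hv] at hf2
  have hf3 : |u ^ 2 + σ * v ^ 2| ≤ ρ * v ^ 2 := by
    have : v * |u ^ 2 + σ * v ^ 2| ≤ v * (ρ * v ^ 2) := by nlinarith
    exact le_of_mul_le_mul_left this hv
  have hu2 := abs_le.mp hu
  have hf4 := abs_le.mp hf3
  rcases hσ with rfl | rfl
  · exfalso
    nlinarith [sq_nonneg u, hf4.2, mul_pos hv hv, mul_pos (sub_pos.mpr h1) (mul_pos hv hv)]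
  · rcases le_total 0 u with hs | hs
    · refine ⟨1, by simp, ?_⟩
      rw [one_mul, abs_sub_comm, abs_of_nonneg (by linarith)]
      have h4 : (v - u) * v ≤ (ρ * v) * v := by nlinarith [hf4.1]
      have := le_of_mul_le_mul_right h4 hv
      nlinarith [mul_nonneg hρ hv.le]
    · refine ⟨-1, by simp, ?_⟩
      rw [show u - -1 * v = u + v by ring, abs_of_nonneg (by linarith)]
      have h4 : (u + v) * v ≤ (ρ * v) * v := by nlinarith [hf4.1]
      have := le_of_mul_le_mul_right h4 hv
      nlinarith [mul_nonneg hρ hv.le]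

/-- slopes classification -/
theorem slope_class (σ u v M ρ : ℝ) (hσ : σ = 1 ∨ σ = -1) (hM : 0 < M) (hρ : 0 ≤ ρ)
    (hm : 1 ≤ ρ ∨ M / 2 < max |u| |v|) (h0 : u ≠ 0 ∨ v ≠ 0)
    (hf : 1 ≤ ρ ∨ |v * (u ^ 2 + σ * v ^ 2)| ≤ ρ * M ^ 3 / 8) :
    ∃ e ∈ ({1, -1} : Finset ℝ), ∃ t ∈ ({0, 1, -1} : Finset ℝ),
      (0 < e * u ∧ |e * v - t * (e * u)| ≤ 2 * ρ * (e * u)) ∨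
      (0 < e * v ∧ |e * u - t * (e * v)| ≤ 2 * ρ * (e * v)) := by
  have hneg : |(-1 * v) * ((-1 * u) ^ 2 + σ * (-1 * v) ^ 2)| = |v * (u ^ 2 + σ * v ^ 2)| := by
    rw [← abs_neg]; congr 1; ring
  rcases le_total |v| |u| with h | h
  · rw [max_eq_left h] at hm
    have hu : u ≠ 0 := by
      rintro rfl
      simp at h
      simp [h] at h0
    rcases lt_or_gt_of_ne hu with hs | hs
    · rw [abs_of_neg hs] at hm h
      obtain ⟨t, ht, h2⟩ := slope_A σ (-1 * u) (-1 * v) M ρ hσ hM hρ (by simpa using hm)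
        (by linarith) (by simpa using h) (by rwa [hneg])
      exact ⟨-1, by simp, t, ht, Or.inl ⟨by linarith, h2⟩⟩
    · rw [abs_of_pos hs] at hm h
      obtain ⟨t, ht, h2⟩ := slope_A σ u v M ρ hσ hM hρ hm hs h hf
      exact ⟨1, by simp, t, ht, Or.inl ⟨by linarith, by simpa using h2⟩⟩
  · rw [max_eq_right h] at hm
    have hv : v ≠ 0 := by
      rintro rfl
      simp at h
      simp [h] at h0
    rcases lt_or_gt_of_ne hv with hs | hs
    · rw [abs_of_neg hs] at hm h
      obtain ⟨t, ht, h2⟩ := slope_B σ (-1 * u) (-1 * v) M ρ hσ hM hρ (by simpa using hm)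
        (by linarith) (by simpa using h) (by rwa [hneg])
      exact ⟨-1, by simp, t, ht, Or.inr ⟨by linarith, h2⟩⟩
    · rw [abs_of_pos hs] at hm h
      obtain ⟨t, ht, h2⟩ := slope_B σ u v M ρ hσ hM hρ hm hs h hf
      exact ⟨1, by simp, t, ht, Or.inr ⟨by linarith, by simpa using h2⟩⟩

theorem scale_card0 (σ u1 u2 v1 v2 M ρ : ℝ) (hσ : σ = 1 ∨ σ = -1) (hM : 0 < M) (hρ : 0 ≤ ρ)
    (hdet : u1 * v2 - u2 * v1 = 1) (S : Finset (ℤ × ℤ))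
    (hS : ∀ w ∈ S, IsCoprime w.1 w.2 ∧
      max |u1 * w.1 + u2 * w.2| |v1 * w.1 + v2 * w.2| ≤ M ∧
      (1 ≤ ρ ∨ M / 2 < max |u1 * w.1 + u2 * w.2| |v1 * w.1 + v2 * w.2|) ∧
      (1 ≤ ρ ∨ |(v1 * w.1 + v2 * w.2) * ((u1 * w.1 + u2 * w.2) ^ 2 +
        σ * (v1 * w.1 + v2 * w.2) ^ 2)| ≤ ρ * M ^ 3 / 8)) :
    (S.card : ℝ) ≤ 12 * (1 + 4 * ρ * M ^ 2) := by
  classical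
  let P1 : ℝ × ℝ → Finset (ℤ × ℤ) := fun et => S.filter fun w =>
    0 < et.1 * (u1 * w.1 + u2 * w.2) ∧ |et.1 * (v1 * w.1 + v2 * w.2) -
      et.2 * (et.1 * (u1 * w.1 + u2 * w.2))| ≤ 2 * ρ * (et.1 * (u1 * w.1 + u2 * w.2))
  let P2 : ℝ × ℝ → Finset (ℤ × ℤ) := fun et => S.filter fun w =>
    0 < et.1 * (v1 * w.1 + v2 * w.2) ∧ |et.1 * (u1 * w.1 + u2 * w.2) -
      et.2 * (et.1 * (v1 * w.1 + v2 * w.2))| ≤ 2 * ρ * (et.1 * (v1 * w.1 + v2 * w.2))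
  let I : Finset (ℝ × ℝ) := ({1, -1} : Finset ℝ) ×ˢ ({0, 1, -1} : Finset ℝ)
  have hI : I.card ≤ 6 := by
    rw [Finset.card_product]
    exact Nat.mul_le_mul Finset.card_le_two Finset.card_le_three
  have hcov : S ⊆ I.biUnion (fun et => P1 et ∪ P2 et) := by
    intro w hw
    obtain ⟨hc, h1, h2, h3⟩ := hS w hw
    have h0 : u1 * w.1 + u2 * w.2 ≠ 0 ∨ v1 * w.1 + v2 * w.2 ≠ 0 := by
      by_contra hcon
      push Not at hcon
      obtain ⟨x, y⟩ := hcon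
      have a1 : (w.1 : ℝ) = 0 := by
        linear_combination v2 * x - u2 * y - (w.1 : ℝ) * hdet
      have a2 : (w.2 : ℝ) = 0 := by
        linear_combination u1 * y - v1 * x - (w.2 : ℝ) * hdet
      have a1' : w.1 = 0 := by exact_mod_cast a1
      have a2' : w.2 = 0 := by exact_mod_cast a2
      rw [a1', a2'] at hc
      obtain ⟨x', y', hc⟩ := hc
      simp at hc
    obtain ⟨e, he, t, ht, hh⟩ := slope_class σ _ _ M ρ hσ hM hρ h2 h0 h3
    rw [Finset.mem_biUnion]
    refine ⟨(e, t), Finset.mk_mem_product he ht, ?_⟩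
    rw [Finset.mem_union]
    rcases hh with hh | hh
    · left; exact Finset.mem_filter.mpr ⟨hw, hh⟩
    · right; exact Finset.mem_filter.mpr ⟨hw, hh⟩
  have hb : ∀ et ∈ I, ((P1 et ∪ P2 et).card : ℝ) ≤ 2 * (1 + 4 * ρ * M ^ 2) := by
    rintro ⟨e, t⟩ het
    have he : |e| = 1 ∧ e * e = 1 := by
      have := (Finset.mem_product.mp het).1
      simp at this
      rcases this with rfl | rfl <;> simp
    have c1 : ((P1 (e, t)).card : ℝ) ≤ 1 + 2 * (2 * ρ) * M ^ 2 := by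
      apply chart_card (e * u1) (e * u2) (e * v1) (e * v2) _ M (2 * ρ) t (by positivity)
      · intro w hw
        obtain ⟨hw, x, y⟩ := Finset.mem_filter.mp hw
        obtain ⟨hc, h1, -, -⟩ := hS w hw
        have r1 : e * u1 * w.1 + e * u2 * w.2 = e * (u1 * w.1 + u2 * w.2) := by ring
        have r2 : e * v1 * w.1 + e * v2 * w.2 = e * (v1 * w.1 + v2 * w.2) := by ring
        rw [r1, r2]
        refine ⟨hc, x, ?_, y⟩
        calc _ ≤ |e * (u1 * w.1 + u2 * w.2)| := le_abs_self _
          _ = |u1 * w.1 + u2 * w.2| := by rw [abs_mul, he.1, one_mul]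
          _ ≤ M := (le_max_left _ _).trans h1
      · rw [show e * u1 * (e * v2) - e * u2 * (e * v1) = (e * e) * (u1 * v2 - u2 * v1) by ring,
          he.2, hdet]; simp
    have c2 : ((P2 (e, t)).card : ℝ) ≤ 1 + 2 * (2 * ρ) * M ^ 2 := by
      apply chart_card (e * v1) (e * v2) (e * u1) (e * u2) _ M (2 * ρ) t (by positivity)
      · intro w hw
        obtain ⟨hw, x, y⟩ := Finset.mem_filter.mp hw
        obtain ⟨hc, h1, -, -⟩ := hS w hw
        have r1 : e * u1 * w.1 + e * u2 * w.2 = e * (u1 * w.1 + u2 * w.2) := by ring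
        have r2 : e * v1 * w.1 + e * v2 * w.2 = e * (v1 * w.1 + v2 * w.2) := by ring
        rw [r1, r2]
        refine ⟨hc, x, ?_, y⟩
        calc _ ≤ |e * (v1 * w.1 + v2 * w.2)| := le_abs_self _
          _ = |v1 * w.1 + v2 * w.2| := by rw [abs_mul, he.1, one_mul]
          _ ≤ M := (le_max_right _ _).trans h1
      · rw [show e * v1 * (e * u2) - e * v2 * (e * u1) = -((e * e) * (u1 * v2 - u2 * v1)) by ring,
          he.2, hdet]; simp
    have c3 : ((P1 (e, t) ∪ P2 (e, t)).card : ℝ) ≤ (P1 (e, t)).card + (P2 (e, t)).card := by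
      exact_mod_cast Finset.card_union_le _ _
    linarith
  have k1 : (S.card : ℝ) ≤ ∑ et ∈ I, ((P1 et ∪ P2 et).card : ℝ) := by
    exact_mod_cast (Finset.card_le_card hcov).trans Finset.card_biUnion_le
  have k2 := k1.trans (Finset.sum_le_sum hb)
  rw [Finset.sum_const, nsmul_eq_mul] at k2
  have hI' : (I.card : ℝ) ≤ 6 := by exact_mod_cast hI
  have : 0 ≤ 2 * (1 + 4 * ρ * M ^ 2) := by positivity
  nlinarith

theorem scale_card (σ u1 u2 v1 v2 M Z : ℝ) (hσ : σ = 1 ∨ σ = -1) (hM : 0 < M) (hZ : 0 ≤ Z)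
    (hdet : u1 * v2 - u2 * v1 = 1) (S : Finset (ℤ × ℤ))
    (hS : ∀ w ∈ S, IsCoprime w.1 w.2 ∧
      max |u1 * w.1 + u2 * w.2| |v1 * w.1 + v2 * w.2| ≤ M ∧
      (M ≤ 1 ∨ M / 2 < max |u1 * w.1 + u2 * w.2| |v1 * w.1 + v2 * w.2|) ∧
      |(v1 * w.1 + v2 * w.2) * ((u1 * w.1 + u2 * w.2) ^ 2 +
        σ * (v1 * w.1 + v2 * w.2) ^ 2)| ≤ Z ^ 3) :
    (S.card : ℝ) ≤ 12 * (5 + 16 * Z ^ 2) := by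
  by_cases h1 : M ≤ 1 ∨ M ≤ 2 * Z
  · have := scale_card0 σ u1 u2 v1 v2 M 1 hσ hM zero_le_one hdet S (by
      intro w hw
      obtain ⟨a, b, c, d⟩ := hS w hw
      exact ⟨a, b, Or.inl le_rfl, Or.inl le_rfl⟩)
    have h2 : M ^ 2 ≤ 1 + 4 * Z ^ 2 := by
      rcases h1 with h | h <;> nlinarith
    linarith
  · push Not at h1
    obtain ⟨h1, h2⟩ := h1
    have := scale_card0 σ u1 u2 v1 v2 M (8 * Z ^ 3 / M ^ 3) hσ hM (by positivity) hdet S (by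
      intro w hw
      obtain ⟨a, b, c, d⟩ := hS w hw
      refine ⟨a, b, Or.inr (c.resolve_left (by linarith)), Or.inr ?_⟩
      have : 8 * Z ^ 3 / M ^ 3 * M ^ 3 / 8 = Z ^ 3 := by field_simp
      rw [this]; exact d)
    have h3 : 8 * Z ^ 3 / M ^ 3 * M ^ 2 ≤ 4 * Z ^ 2 := by
      rw [show 8 * Z ^ 3 / M ^ 3 * M ^ 2 = 8 * Z ^ 3 / M by field_simp, div_le_iff₀ hM]
      nlinarith [sq_nonneg Z]
    linarith

/-- number of primitive vectors with small value of the form. -/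
theorem prim_card (σ u1 u2 v1 v2 Z : ℝ) (J : ℕ) (hσ : σ = 1 ∨ σ = -1) (hZ : 0 ≤ Z)
    (hdet : u1 * v2 - u2 * v1 = 1) (S : Finset (ℤ × ℤ))
    (hS : ∀ w ∈ S, IsCoprime w.1 w.2 ∧
      max |u1 * w.1 + u2 * w.2| |v1 * w.1 + v2 * w.2| ≤ 2 ^ J ∧
      |(v1 * w.1 + v2 * w.2) * ((u1 * w.1 + u2 * w.2) ^ 2 +
        σ * (v1 * w.1 + v2 * w.2) ^ 2)| ≤ Z ^ 3) :
    (S.card : ℝ) ≤ (J + 1) * (12 * (5 + 16 * Z ^ 2)) := by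
  induction J generalizing S with
  | zero =>
    have := scale_card σ u1 u2 v1 v2 1 Z hσ one_pos hZ hdet S (by
      intro w hw
      obtain ⟨a, b, c⟩ := hS w hw
      exact ⟨a, by simpa using b, Or.inl le_rfl, c⟩)
    simpa using this
  | succ J ih =>
    classical
    let Q : ℤ × ℤ → Prop := fun w =>
      max |u1 * w.1 + u2 * w.2| |v1 * w.1 + v2 * w.2| ≤ 2 ^ J
    have e := Finset.card_filter_add_card_filter_not (s := S) Q
    have i1 := ih (S.filter Q) (by
      intro w hw
      obtain ⟨hw, hq⟩ := Finset.mem_filter.mp hw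
      obtain ⟨a, b, c⟩ := hS w hw
      exact ⟨a, hq, c⟩)
    have i2 := scale_card σ u1 u2 v1 v2 (2 ^ (J + 1)) Z hσ (by positivity) hZ hdet
      (S.filter (fun w => ¬ Q w)) (by
      intro w hw
      obtain ⟨hw, hq⟩ := Finset.mem_filter.mp hw
      obtain ⟨a, b, c⟩ := hS w hw
      refine ⟨a, b, Or.inr ?_, c⟩
      have : (2 : ℝ) ^ (J + 1) / 2 = 2 ^ J := by rw [pow_succ]; ring
      rw [this]
      exact not_le.mp hq)
    have e' : (S.card : ℝ) = (S.filter Q).card + (S.filter (fun w => ¬ Q w)).card := by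
      exact_mod_cast e.symm
    rw [e']
    push_cast
    linarith


/-- number of unimodular matrices for which both columns are small -/
theorem half_card (σ u1 u2 v1 v2 Z : ℝ) (J : ℕ) (hσ : σ = 1 ∨ σ = -1) (hZ : 0 ≤ Z)
    (hdet : u1 * v2 - u2 * v1 = 1) (S : Finset ((ℤ × ℤ) × (ℤ × ℤ)))
    (hS : ∀ g ∈ S, |g.1.1 * g.2.2 - g.2.1 * g.1.2| = 1 ∧
      (∃ e : ℤ, ∀ g' ∈ S, g'.1.1 * g'.2.2 - g'.2.1 * g'.1.2 = e) ∧
      max |u1 * g.2.1 + u2 * g.2.2| |v1 * g.2.1 + v2 * g.2.2| ≤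
        max |u1 * g.1.1 + u2 * g.1.2| |v1 * g.1.1 + v2 * g.1.2| ∧
      max |u1 * g.1.1 + u2 * g.1.2| |v1 * g.1.1 + v2 * g.1.2| ≤ 2 ^ J ∧
      |(v1 * g.1.1 + v2 * g.1.2) * ((u1 * g.1.1 + u2 * g.1.2) ^ 2 +
        σ * (v1 * g.1.1 + v2 * g.1.2) ^ 2)| ≤ Z ^ 3) :
    (S.card : ℝ) ≤ 5 * ((J + 1) * (12 * (5 + 16 * Z ^ 2))) := by
  classical
  have hcop : ∀ g ∈ S, IsCoprime g.1.1 g.1.2 := by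
    intro g hg
    obtain ⟨h1, -⟩ := hS g hg
    rcases (abs_eq (zero_le_one)).mp h1 with h | h
    · exact ⟨g.2.2, -g.2.1, by linear_combination h⟩
    · exact ⟨-g.2.2, g.2.1, by linear_combination -h⟩
  have h1 := Finset.card_le_mul_card_image (f := Prod.fst) S 5 (by
    intro w hw
    obtain ⟨g, hg, rfl⟩ := Finset.mem_image.mp hw
    have hsub : (S.filter fun a => a.1 = g.1) ⊆ (Finset.Icc (-2 : ℤ) 2).image
        (fun n : ℤ => (g.1, (g.2.1 + n * g.1.1, g.2.2 + n * g.1.2))) := by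
      intro g' hg'
      obtain ⟨hg', heq⟩ := Finset.mem_filter.mp hg'
      obtain ⟨hd, ⟨e, he⟩, hle, -, -⟩ := hS g hg
      obtain ⟨hd', -, hle', -, -⟩ := hS g' hg'
      have d1 := he g hg
      have d2 := he g' hg'
      rw [heq] at d2 hle'
      obtain ⟨x, y, hxy⟩ := hcop g hg
      set n := x * (g'.2.1 - g.2.1) + y * (g'.2.2 - g.2.2) with hn
      have hn1 : g'.2.1 = g.2.1 + n * g.1.1 := by
        rw [hn]; linear_combination (-(g'.2.1 - g.2.1)) * hxy - y * (d2 - d1)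
      have hn2 : g'.2.2 = g.2.2 + n * g.1.2 := by
        rw [hn]; linear_combination (-(g'.2.2 - g.2.2)) * hxy + x * (d2 - d1)
      set m := max |u1 * (g.1.1 : ℝ) + u2 * g.1.2| |v1 * (g.1.1 : ℝ) + v2 * g.1.2| with hm
      have a1 := (le_max_left _ _).trans hle
      have a2 := (le_max_right _ _).trans hle
      have b1 := (le_max_left _ _).trans hle'
      have b2 := (le_max_right _ _).trans hle'
      rw [hn1, hn2] at b1 b2
      push_cast at b1 b2
      have c1 : |(n : ℝ)| * |u1 * (g.1.1 : ℝ) + u2 * g.1.2| ≤ 2 * m := by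
        rw [← abs_mul]
        have : (n : ℝ) * (u1 * (g.1.1 : ℝ) + u2 * g.1.2) =
          (u1 * (g.2.1 + n * g.1.1) + u2 * (g.2.2 + n * g.1.2)) - (u1 * g.2.1 + u2 * g.2.2) := by
          ring
        rw [this]
        exact (abs_sub _ _).trans (by linarith)
      have c2 : |(n : ℝ)| * |v1 * (g.1.1 : ℝ) + v2 * g.1.2| ≤ 2 * m := by
        rw [← abs_mul]
        have : (n : ℝ) * (v1 * (g.1.1 : ℝ) + v2 * g.1.2) =
          (v1 * (g.2.1 + n * g.1.1) + v2 * (g.2.2 + n * g.1.2)) - (v1 * g.2.1 + v2 * g.2.2) := by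
          ring
        rw [this]
        exact (abs_sub _ _).trans (by linarith)
      have hmpos : 0 < m := by
        by_contra hcon
        have z1 : u1 * (g.1.1 : ℝ) + u2 * g.1.2 = 0 := by
          rw [← abs_nonpos_iff]; exact (le_max_left _ _).trans (not_lt.mp hcon)
        have z2 : v1 * (g.1.1 : ℝ) + v2 * g.1.2 = 0 := by
          rw [← abs_nonpos_iff]; exact (le_max_right _ _).trans (not_lt.mp hcon)
        have y1 : (g.1.1 : ℝ) = 0 := by
          linear_combination v2 * z1 - u2 * z2 - (g.1.1 : ℝ) * hdet
        have y2 : (g.1.2 : ℝ) = 0 := by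
          linear_combination u1 * z2 - v1 * z1 - (g.1.2 : ℝ) * hdet
        have y1' : g.1.1 = 0 := by exact_mod_cast y1
        have y2' : g.1.2 = 0 := by exact_mod_cast y2
        rw [y1', y2'] at hxy
        simp at hxy
      have c3 : |(n : ℝ)| * m ≤ 2 * m := by
        rcases max_choice |u1 * (g.1.1 : ℝ) + u2 * g.1.2| |v1 * (g.1.1 : ℝ) + v2 * g.1.2|
          with h | h
        · rw [← hm] at h; rw [← h] at c1; exact c1
        · rw [← hm] at h; rw [← h] at c2; exact c2
      have c4 : |(n : ℝ)| ≤ 2 := le_of_mul_le_mul_right c3 hmpos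
      have c5 : |n| ≤ 2 := by exact_mod_cast c4
      rw [Finset.mem_image]
      refine ⟨n, Finset.mem_Icc.mpr (abs_le.mp c5), ?_⟩
      ext
      · simp [heq]
      · simp [heq]
      · simp [hn1]
      · simp [hn2]
    calc _ ≤ _ := Finset.card_le_card hsub
      _ ≤ _ := Finset.card_image_le
      _ = 5 := by simp)
  have h2 := prim_card σ u1 u2 v1 v2 Z J hσ hZ hdet (S.image Prod.fst) (by
    intro w hw
    obtain ⟨g, hg, rfl⟩ := Finset.mem_image.mp hw
    obtain ⟨-, -, -, h3, h4⟩ := hS g hg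
    exact ⟨hcop g hg, h3, h4⟩)
  have h1' : (S.card : ℝ) ≤ 5 * (S.image Prod.fst).card := by exact_mod_cast h1
  linarith

theorem pair_card (σ u1 u2 v1 v2 Z : ℝ) (J : ℕ) (hσ : σ = 1 ∨ σ = -1) (hZ : 0 ≤ Z)
    (hdet : u1 * v2 - u2 * v1 = 1) (S : Finset ((ℤ × ℤ) × (ℤ × ℤ)))
    (hS : ∀ g ∈ S, g.1.1 * g.2.2 - g.2.1 * g.1.2 = 1 ∧
      max |u1 * g.1.1 + u2 * g.1.2| |v1 * g.1.1 + v2 * g.1.2| ≤ 2 ^ J ∧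
      |(v1 * g.1.1 + v2 * g.1.2) * ((u1 * g.1.1 + u2 * g.1.2) ^ 2 +
        σ * (v1 * g.1.1 + v2 * g.1.2) ^ 2)| ≤ Z ^ 3 ∧
      max |u1 * g.2.1 + u2 * g.2.2| |v1 * g.2.1 + v2 * g.2.2| ≤ 2 ^ J ∧
      |(v1 * g.2.1 + v2 * g.2.2) * ((u1 * g.2.1 + u2 * g.2.2) ^ 2 +
        σ * (v1 * g.2.1 + v2 * g.2.2) ^ 2)| ≤ Z ^ 3) :
    (S.card : ℝ) ≤ 10 * ((J + 1) * (12 * (5 + 16 * Z ^ 2))) := by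
  classical
  let Q : (ℤ × ℤ) × (ℤ × ℤ) → Prop := fun g =>
      max |u1 * g.2.1 + u2 * g.2.2| |v1 * g.2.1 + v2 * g.2.2| ≤
        max |u1 * g.1.1 + u2 * g.1.2| |v1 * g.1.1 + v2 * g.1.2|
  have e := Finset.card_filter_add_card_filter_not (s := S) Q
  have i1 := half_card σ u1 u2 v1 v2 Z J hσ hZ hdet (S.filter Q) (by
    intro g hg
    obtain ⟨hg, hq⟩ := Finset.mem_filter.mp hg
    obtain ⟨h1, h2, h3, -, -⟩ := hS g hg
    refine ⟨by rw [h1]; simp, ⟨1, ?_⟩, hq, h2, h3⟩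
    intro g' hg'
    exact (hS g' (Finset.mem_filter.mp hg').1).1)
  have i2 := half_card σ u1 u2 v1 v2 Z J hσ hZ hdet ((S.filter (fun g => ¬ Q g)).image Prod.swap) (by
    intro g hg
    obtain ⟨g0, hg0, rfl⟩ := Finset.mem_image.mp hg
    obtain ⟨hg1, hq⟩ := Finset.mem_filter.mp hg0
    obtain ⟨h1, -, -, h2, h3⟩ := hS g0 hg1
    refine ⟨?_, ⟨-1, ?_⟩, (not_le.mp hq).le, h2, h3⟩
    · rw [show g0.swap.1.1 * g0.swap.2.2 - g0.swap.2.1 * g0.swap.1.2 = -1 by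
        simp only [Prod.fst_swap, Prod.snd_swap]; linear_combination -h1]
      simp
    · intro g' hg'
      obtain ⟨g1, hg1, rfl⟩ := Finset.mem_image.mp hg'
      have := (hS g1 (Finset.mem_filter.mp hg1).1).1
      simp only [Prod.fst_swap, Prod.snd_swap]; linear_combination -this)
  rw [Finset.card_image_of_injective _ Prod.swap_injective] at i2
  have e' : (S.card : ℝ) = (S.filter Q).card + (S.filter (fun w => ¬ Q w)).card := by
    exact_mod_cast e.symm
  linarith

theorem col_bound (σ k u v H T A P : ℝ) (hσ : σ = 1 ∨ σ = -1) (hk : k ≠ 0)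
    (hT : T = H / |k|) (hT2 : 1 / 2 ≤ T)
    (hA : A = k * (v * (u ^ 2 + σ * v ^ 2))) (hP : P = k ^ 2 * (u ^ 2 - 3 * σ * v ^ 2))
    (hA2 : |A| ≤ H) (hP2 : |P| ≤ 4 * H ^ 2) :
    |v * (u ^ 2 + σ * v ^ 2)| ≤ T ∧ max |u| |v| ≤ 4 * T := by
  have hk' : 0 < |k| := abs_pos.mpr hk
  have h1 : |v * (u ^ 2 + σ * v ^ 2)| ≤ T := by
    rw [hT, le_div_iff₀ hk', mul_comm, ← abs_mul, ← hA]; exact hA2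
  have h2 : |u ^ 2 - 3 * σ * v ^ 2| ≤ 4 * T ^ 2 := by
    rw [hT, div_pow, sq_abs, ← mul_div_assoc, le_div_iff₀ (by positivity)]
    rw [hP, abs_mul, abs_of_pos (by positivity : 0 < k ^ 2)] at hP2
    linarith
  refine ⟨h1, ?_⟩
  have h3 := abs_le.mp h2
  have key : u ^ 2 ≤ (4 * T) ^ 2 ∧ v ^ 2 ≤ (4 * T) ^ 2 := by
    rcases hσ with rfl | rfl
    · have hv : |v| ≤ 2 * T := by
        by_contra hcon
        push Not at hcon
        rw [abs_mul, abs_of_nonneg (by positivity : 0 ≤ u ^ 2 + 1 * v ^ 2)] at h1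
        have hv2 : v ^ 2 = |v| ^ 2 := (sq_abs v).symm
        have : 2 * T < v ^ 2 := by rw [hv2]; nlinarith
        nlinarith [sq_nonneg u, abs_nonneg v]
      have hv2 : v ^ 2 ≤ 4 * T ^ 2 := by
        rw [← sq_abs]; nlinarith [abs_nonneg v]
      constructor <;> nlinarith
    · constructor <;> nlinarith [sq_nonneg u, sq_nonneg v]
  exact max_le (abs_le_of_sq_le_sq key.1 (by linarith)) (abs_le_of_sq_le_sq key.2 (by linarith))

def Cub.ht (F : Cub ℤ) (H : ℝ) : Prop :=
  |(F.a : ℝ)| ≤ H ∧ |(F.b : ℝ)| ≤ H ∧ |(F.c : ℝ)| ≤ H ∧ |(F.d : ℝ)| ≤ H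

theorem disc_le (F : Cub ℤ) (H : ℝ) (h : F.ht H) : |(F.disc : ℝ)| ≤ 54 * H ^ 4 := by
  obtain ⟨ha, hb, hc, hd⟩ := h
  have hH : 0 ≤ H := (abs_nonneg _).trans ha
  have m4 : ∀ x y z w : ℝ, |x| ≤ H → |y| ≤ H → |z| ≤ H → |w| ≤ H → |x * y * z * w| ≤ H ^ 4 := by
    intro x y z w hx hy hz hw
    rw [abs_mul, abs_mul, abs_mul]
    calc |x| * |y| * |z| * |w| ≤ H * H * H * H := by gcongr
      _ = H ^ 4 := by ring
  have t1 := abs_le.mp (m4 _ _ _ _ hc hc hb hb)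
  have t2 := abs_le.mp (m4 _ _ _ _ hd hb hb hb)
  have t3 := abs_le.mp (m4 _ _ _ _ hc hc hc ha)
  have t4 := abs_le.mp (m4 _ _ _ _ hd hd ha ha)
  have t5 := abs_le.mp (m4 _ _ _ _ hd hc hb ha)
  have e : (F.disc : ℝ) = F.c * F.c * F.b * F.b - 4 * (F.d * F.b * F.b * F.b) -
    4 * (F.c * F.c * F.c * F.a) - 27 * (F.d * F.d * F.a * F.a) + 18 * (F.d * F.c * F.b * F.a) := by
    simp only [disc]; push_cast; ring
  rw [e, abs_le]
  constructor <;> linarith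

theorem hess_bound (x y z H : ℝ) (hx : |x| ≤ H) (hy : |y| ≤ H) (hz : |z| ≤ H) :
    |x ^ 2 - 3 * y * z| ≤ 4 * H ^ 2 := by
  have h0 : 0 ≤ H := (abs_nonneg x).trans hx
  have h1 : |x * x| ≤ H * H := by rw [abs_mul]; gcongr
  have h2 : |y * z| ≤ H * H := by rw [abs_mul]; gcongr
  have t1 := abs_le.mp h1
  have t2 := abs_le.mp h2
  rw [abs_le]; constructor <;> nlinarith

/-- number of elements of an orbit with bounded height -/
theorem orbit_card (F : Cub ℤ) (H Z k : ℝ) (J : ℕ) (hH : 1 ≤ H) (hk : 0 < k)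
    (hdisc : |(F.disc : ℝ)| = 4 * k ^ 4) (hZ : 0 ≤ Z) (hZ3 : H / k ≤ Z ^ 3) (hJ : 8 * H ≤ 2 ^ J)
    (S : Finset ((ℤ × ℤ) × (ℤ × ℤ)))
    (hS : ∀ g ∈ S, g.1.1 * g.2.2 - g.2.1 * g.1.2 = 1 ∧
      (F.act g.1.1 g.2.1 g.1.2 g.2.2).ht H) :
    (S.card : ℝ) ≤ 10 * ((J + 1) * (12 * (5 + 16 * Z ^ 2))) := by
  rcases S.eq_empty_or_nonempty with rfl | ⟨g0, hg0⟩
  · simp; positivity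
  have hF0 : F.disc ≠ 0 := by
    intro h
    rw [h] at hdisc
    simp at hdisc
    exact hk.ne' hdisc
  have hk2 : k ≤ 2 * H := by
    obtain ⟨h1, h2⟩ := hS g0 hg0
    have := disc_le _ H h2
    rw [disc_act, h1, one_pow, one_mul, hdisc] at this
    by_contra hcon
    push Not at hcon
    have : (2 * H) ^ 4 < k ^ 4 := by gcongr
    nlinarith [pow_pos (by linarith : 0 < H) 4]
  have hk1 : 1 / 2 ≤ k := by
    by_contra hcon
    push Not at hcon
    have h1 : k ^ 4 < (1 / 2) ^ 4 := by gcongr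
    have h2 : (1 : ℝ) ≤ |(F.disc : ℝ)| := by exact_mod_cast Int.one_le_abs hF0
    norm_num at h1
    linarith
  obtain ⟨k', σ, u1, u2, v1, v2, hdec⟩ := exists_dec F.toReal (by
    rw [toReal_disc]; exact_mod_cast hF0)
  have hkk : |k'| = k := by
    have := hdec.disc
    rw [toReal_disc, hdisc] at this
    have h2 : |k'| ^ 4 = k ^ 4 := by
      rw [(by norm_num : Even 4).pow_abs]; linarith
    exact (pow_left_inj₀ (abs_nonneg _) hk.le (by norm_num)).mp h2
  have hT2 : 1 / 2 ≤ H / k := by rw [le_div_iff₀ hk]; linarith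
  have hT3 : 4 * (H / k) ≤ 2 ^ J := by
    refine le_trans ?_ hJ
    rw [← mul_div_assoc, div_le_iff₀ hk]; nlinarith
  obtain ⟨hk0, hσ, hdet, -⟩ := id hdec
  apply pair_card σ u1 u2 v1 v2 Z J hσ hZ hdet S
  intro g hg
  obtain ⟨h1, h2⟩ := hS g hg
  have h1R : (g.1.1 : ℝ) * g.2.2 - g.2.1 * g.1.2 = 1 := by exact_mod_cast h1
  have hdec2 := hdec.act h1R
  rw [← toReal_act] at hdec2
  obtain ⟨-, -, hdet2, heq⟩ := hdec2
  set G := F.act g.1.1 g.2.1 g.1.2 g.2.2 with hG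
  obtain ⟨ha, hb, hc, hd⟩ := h2
  set U1 := u1 * (g.1.1 : ℝ) + u2 * g.1.2
  set U2 := u1 * (g.2.1 : ℝ) + u2 * g.2.2
  set V1 := v1 * (g.1.1 : ℝ) + v2 * g.1.2
  set V2 := v1 * (g.2.1 : ℝ) + v2 * g.2.2
  clear_value G U1 U2 V1 V2
  have ea : (G.a : ℝ) = k' * (V1 * (U1 ^ 2 + σ * V1 ^ 2)) := by
    have := congrArg Cub.a heq
    simp only [toReal, Cub.act, nf] at this
    rw [this]; ring
  have ed : (G.d : ℝ) = k' * (V2 * (U2 ^ 2 + σ * V2 ^ 2)) := by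
    have := congrArg Cub.d heq
    simp only [toReal, Cub.act, nf] at this
    rw [this]; ring
  have eb : (G.b : ℝ) = k' * (U1 ^ 2 * V2 + 2 * U1 * U2 * V1 + 3 * σ * V1 ^ 2 * V2) := by
    have := congrArg Cub.b heq
    simp only [toReal, Cub.act, nf] at this
    rw [this]; ring
  have ec : (G.c : ℝ) = k' * (U2 ^ 2 * V1 + 2 * U1 * U2 * V2 + 3 * σ * V1 * V2 ^ 2) := by
    have := congrArg Cub.c heq
    simp only [toReal, Cub.act, nf] at this
    rw [this]; ring
  have p1 : |(G.b : ℝ) ^ 2 - 3 * G.a * G.c| ≤ 4 * H ^ 2 := hess_bound _ _ _ _ hb ha hc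
  have p2 : |(G.c : ℝ) ^ 2 - 3 * G.b * G.d| ≤ 4 * H ^ 2 := hess_bound _ _ _ _ hc hb hd
  have q1 : (G.b : ℝ) ^ 2 - 3 * G.a * G.c = k' ^ 2 * (U1 ^ 2 - 3 * σ * V1 ^ 2) := by
    have : (G.b : ℝ) ^ 2 - 3 * G.a * G.c =
        k' ^ 2 * (U1 ^ 2 - 3 * σ * V1 ^ 2) * (U1 * V2 - U2 * V1) ^ 2 := by
      rw [ea, eb, ec]; ring
    rw [this, hdet2]; ring
  have q2 : (G.c : ℝ) ^ 2 - 3 * G.b * G.d = k' ^ 2 * (U2 ^ 2 - 3 * σ * V2 ^ 2) := by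
    have : (G.c : ℝ) ^ 2 - 3 * G.b * G.d =
        k' ^ 2 * (U2 ^ 2 - 3 * σ * V2 ^ 2) * (U1 * V2 - U2 * V1) ^ 2 := by
      rw [ed, eb, ec]; ring
    rw [this, hdet2]; ring
  have r1 := col_bound σ k' U1 V1 H (H / k) _ _ hσ hk0 (by rw [hkk]) hT2 ea q1 ha p1
  have r2 := col_bound σ k' U2 V2 H (H / k) _ _ hσ hk0 (by rw [hkk]) hT2 ed q2 hd p2
  exact ⟨h1, r1.2.trans hT3, r1.1.trans hZ3, r2.2.trans hT3, r2.1.trans hZ3⟩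


/-- pairs of integers with bounded product -/
def pairsE (N : ℕ) (w : ℤ × ℤ) : Prop :=
  w.1.natAbs ≤ N ∧ w.2.natAbs ≤ N ∧ w.1.natAbs * w.2.natAbs ≤ N

theorem pairsE_card (N : ℕ) (hN : 1 ≤ N) (S : Finset (ℤ × ℤ)) (hS : ∀ w ∈ S, pairsE N w) :
    (S.card : ℝ) ≤ 16 * N * (1 + Real.log N) := by
  classical
  let f : ℤ × ℤ → ℕ × ℕ := fun w => (w.1.natAbs, w.2.natAbs)
  have h1 := Finset.card_le_mul_card_image (f := f) S 4 (by
    intro b hb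
    have hsub : (S.filter fun a => f a = b) ⊆
        ({(b.1 : ℤ), -(b.1 : ℤ)} : Finset ℤ) ×ˢ ({(b.2 : ℤ), -(b.2 : ℤ)} : Finset ℤ) := by
      intro w hw
      obtain ⟨-, h⟩ := Finset.mem_filter.mp hw
      rw [← h]
      simp only [f, Finset.mem_product, Finset.mem_insert, Finset.mem_singleton]
      constructor <;> omega
    refine (Finset.card_le_card hsub).trans ?_
    rw [Finset.card_product]
    exact Nat.mul_le_mul Finset.card_le_two Finset.card_le_two)
  let h : ℕ → ℕ := fun m => if m = 0 then N + 1 else N / m + 1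
  have hsub : S.image f ⊆ (Finset.range (N + 1)).biUnion
      (fun m => (Finset.range (h m)).image (fun n => (m, n))) := by
    intro b hb
    obtain ⟨w, hw, rfl⟩ := Finset.mem_image.mp hb
    obtain ⟨a1, a2, a3⟩ := hS w hw
    rw [Finset.mem_biUnion]
    refine ⟨w.1.natAbs, Finset.mem_range.mpr (by omega), ?_⟩
    rw [Finset.mem_image]
    refine ⟨w.2.natAbs, ?_, rfl⟩
    rw [Finset.mem_range]
    simp only [h]
    split_ifs with h0
    · omega
    · have : w.2.natAbs ≤ N / w.1.natAbs := by
        rw [Nat.le_div_iff_mul_le (Nat.pos_of_ne_zero h0), mul_comm]; exact a3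
      omega
  have h2 : (S.image f).card ≤ ∑ m ∈ Finset.range (N + 1), h m := by
    refine (Finset.card_le_card hsub).trans (Finset.card_biUnion_le.trans ?_)
    apply Finset.sum_le_sum
    intro m _
    exact Finset.card_image_le.trans (by simp)
  rw [Finset.sum_range_succ'] at h2
  have h3 : ((∑ i ∈ Finset.range N, h (i + 1) : ℕ) : ℝ) ≤ N * (1 + Real.log N) + N := by
    have hh := harmonic_le_one_add_log N
    rw [harmonic] at hh
    push_cast at hh
    calc ((∑ i ∈ Finset.range N, h (i + 1) : ℕ) : ℝ)
        ≤ ∑ i ∈ Finset.range N, ((N : ℝ) * ((i : ℝ) + 1)⁻¹ + 1) := by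
          push_cast
          apply Finset.sum_le_sum
          intro i _
          have : h (i + 1) = N / (i + 1) + 1 := by simp [h]
          rw [this]
          push_cast
          have := @Nat.cast_div_le ℝ _ _ _ N (i + 1)
          push_cast at this
          rw [← div_eq_mul_inv]
          linarith
      _ = N * ∑ i ∈ Finset.range N, ((i : ℝ) + 1)⁻¹ + N := by
          rw [Finset.sum_add_distrib, ← Finset.mul_sum]; simp
      _ ≤ _ := by gcongr
  have h0 : h 0 = N + 1 := by simp [h]
  rw [h0] at h2
  have h2' : ((S.image f).card : ℝ) ≤ ((∑ i ∈ Finset.range N, h (i + 1) : ℕ) : ℝ) + (N + 1) := by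
    exact_mod_cast h2
  have h1' : (S.card : ℝ) ≤ 4 * (S.image f).card := by exact_mod_cast h1
  have hN' : (1 : ℝ) ≤ N := by exact_mod_cast hN
  have hlog := Real.log_nonneg hN'
  nlinarith

/-- first type of representatives -/
def Rep1 (N : ℕ) (G : Cub ℤ) : Prop := pairsE N (G.a, G.d) ∧ pairsE N (G.b, G.c)

/-- second type of representatives -/
def Rep2 (N : ℕ) (G : Cub ℤ) : Prop :=
  G.a = 0 ∧ G.b ≠ 0 ∧ |G.c| ≤ |G.b| ∧ G.b ^ 4 ≤ N ∧ |G.b ^ 3 * G.d| ≤ N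

theorem rep1_card (N : ℕ) (hN : 1 ≤ N) (S : Finset (Cub ℤ)) (hS : ∀ G ∈ S, Rep1 N G) :
    (S.card : ℝ) ≤ (16 * N * (1 + Real.log N)) ^ 2 := by
  classical
  let f1 : Cub ℤ → ℤ × ℤ := fun G => (G.a, G.d)
  let f2 : Cub ℤ → ℤ × ℤ := fun G => (G.b, G.c)
  have h1 : S.card ≤ ((S.image f1) ×ˢ (S.image f2)).card := by
    apply Finset.card_le_card_of_injOn (fun G => (f1 G, f2 G))
    · intro G hG
      exact Finset.mk_mem_product (Finset.mem_image_of_mem _ hG) (Finset.mem_image_of_mem _ hG)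
    · intro G _ G' _ h
      simp only [f1, f2, Prod.mk.injEq] at h
      ext
      · exact h.1.1
      · exact h.2.1
      · exact h.2.2
      · exact h.1.2
  rw [Finset.card_product] at h1
  have a1 := pairsE_card N hN (S.image f1) (by
    intro w hw
    obtain ⟨G, hG, rfl⟩ := Finset.mem_image.mp hw
    exact (hS G hG).1)
  have a2 := pairsE_card N hN (S.image f2) (by
    intro w hw
    obtain ⟨G, hG, rfl⟩ := Finset.mem_image.mp hw
    exact (hS G hG).2)
  have h1' : (S.card : ℝ) ≤ (S.image f1).card * (S.image f2).card := by exact_mod_cast h1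
  rw [sq]
  refine h1'.trans (mul_le_mul a1 a2 (by positivity) ?_)
  exact (Nat.cast_nonneg _).trans a1

theorem rep2_card (N : ℕ) (hN : 1 ≤ N) (S : Finset (Cub ℤ)) (hS : ∀ G ∈ S, Rep2 N G) :
    (S.card : ℝ) ≤ 16 * (4 * N : ℕ) * (1 + Real.log (4 * N : ℕ)) := by
  classical
  let f : Cub ℤ → ℤ × ℤ := fun G => (G.b, G.c + (2 * |G.b| + 1) * G.d)
  have hinj : Set.InjOn f S := by
    intro G hG G' hG' h
    obtain ⟨a0, b0, cb, -, -⟩ := hS G hG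
    obtain ⟨a0', b0', cb', -, -⟩ := hS G' hG'
    simp only [f, Prod.mk.injEq] at h
    obtain ⟨hb, h⟩ := h
    rw [← hb] at h cb'
    have c1 := abs_le.mp cb
    have c2 := abs_le.mp cb'
    have e : G.c - G'.c = (2 * |G.b| + 1) * (G'.d - G.d) := by linarith
    have hd : G'.d - G.d = 0 := by
      have hp : 0 < 2 * |G.b| + 1 := by positivity
      by_contra hne
      rcases lt_or_gt_of_ne hne with hlt | hlt
      · have : G'.d - G.d ≤ -1 := by omega
        nlinarith
      · have : 1 ≤ G'.d - G.d := by omega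
        nlinarith
    ext
    · rw [a0, a0']
    · exact hb
    · rw [hd] at e; linarith
    · linarith
  rw [← Finset.card_image_of_injOn hinj]
  apply pairsE_card (4 * N) (by omega)
  intro w hw
  obtain ⟨G, hG, rfl⟩ := Finset.mem_image.mp hw
  obtain ⟨-, b0, cb, b4, bd⟩ := hS G hG
  have hb1 : 1 ≤ |G.b| := Int.one_le_abs b0
  have hb4 : |G.b| ^ 4 ≤ N := by rw [(by norm_num : Even 4).pow_abs]; exact b4
  rw [abs_mul, abs_pow] at bd
  set β := |G.b| with hβ
  have hd0 := abs_nonneg G.d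
  have hb2 : β ^ 2 ≤ β ^ 4 := pow_le_pow_right₀ hb1 (by norm_num)
  have hb3 : β ^ 2 ≤ β ^ 3 := pow_le_pow_right₀ hb1 (by norm_num)
  have hz : |G.c + (2 * β + 1) * G.d| ≤ β + 3 * β * |G.d| := by
    refine (abs_add_le _ _).trans ?_
    rw [abs_mul, abs_of_pos (by positivity : 0 < 2 * β + 1)]
    nlinarith
  have hbz : β * |G.c + (2 * β + 1) * G.d| ≤ 4 * N := by
    have h1 : β * |G.c + (2 * β + 1) * G.d| ≤ β * (β + 3 * β * |G.d|) := by gcongr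
    have h2 : β ^ 2 * |G.d| ≤ β ^ 3 * |G.d| := by gcongr
    nlinarith
  refine ⟨?_, ?_, ?_⟩
  · zify
    simp only [f]
    nlinarith
  · zify
    simp only [f]
    nlinarith [abs_nonneg (G.c + (2 * β + 1) * G.d)]
  · zify
    simp only [f]
    exact hbz


theorem coef_bounds (G : Cub ℝ) (k σ u1 u2 v1 v2 : ℝ) (h : IsDec G k σ u1 u2 v1 v2)
    (h1 : u1 ^ 2 + v1 ^ 2 ≤ u2 ^ 2 + v2 ^ 2) (h2 : 2 * |u1 * u2 + v1 * v2| ≤ u1 ^ 2 + v1 ^ 2) :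
    ∃ x y : ℝ, 0 ≤ x ∧ x ≤ y ∧ x * y ≤ 6 / 5 ∧ |G.a| ≤ |k| * x ^ 3 ∧
      |G.b| ≤ 6 * |k| * (x ^ 2 * y) ∧ |G.c| ≤ 6 * |k| * (x * y ^ 2) ∧ |G.d| ≤ |k| * y ^ 3 := by
  obtain ⟨hk, hσ, hdet, rfl⟩ := h
  set x := √(u1 ^ 2 + v1 ^ 2) with hx
  set y := √(u2 ^ 2 + v2 ^ 2) with hy
  have hx2 : x ^ 2 = u1 ^ 2 + v1 ^ 2 := Real.sq_sqrt (by positivity)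
  have hy2 : y ^ 2 = u2 ^ 2 + v2 ^ 2 := Real.sq_sqrt (by positivity)
  have hx0 : 0 ≤ x := Real.sqrt_nonneg _
  have hy0 : 0 ≤ y := Real.sqrt_nonneg _
  have hxy : x ≤ y := Real.sqrt_le_sqrt h1
  have a1 : |u1| ≤ x := Real.abs_le_sqrt (by nlinarith [sq_nonneg v1])
  have a2 : |v1| ≤ x := Real.abs_le_sqrt (by nlinarith [sq_nonneg u1])
  have a3 : |u2| ≤ y := Real.abs_le_sqrt (by nlinarith [sq_nonneg v2])
  have a4 : |v2| ≤ y := Real.abs_le_sqrt (by nlinarith [sq_nonneg u2])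
  have hσ1 : |σ| = 1 := by rcases hσ with rfl | rfl <;> simp
  have hform : ∀ u v : ℝ, |u ^ 2 + σ * v ^ 2| ≤ u ^ 2 + v ^ 2 := by
    intro u v
    refine (abs_add_le _ _).trans ?_
    rw [abs_mul, hσ1, abs_of_nonneg (sq_nonneg u), abs_of_nonneg (sq_nonneg v)]; linarith
  have hprod : (x * y) ^ 2 ≤ 4 / 3 := by
    have e : (x * y) ^ 2 = 1 + (u1 * u2 + v1 * v2) ^ 2 := by
      have : (x * y) ^ 2 = (u1 * v2 - u2 * v1) ^ 2 + (u1 * u2 + v1 * v2) ^ 2 := by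
        rw [mul_pow, hx2, hy2]; ring
      rw [this, hdet]; ring
    rw [← hx2] at h2
    have h3 : (u1 * u2 + v1 * v2) ^ 2 ≤ (x ^ 2 / 2) ^ 2 := by
      rw [← sq_abs]
      have := abs_nonneg (u1 * u2 + v1 * v2)
      gcongr; linarith
    have h4 : (x ^ 2) ^ 2 ≤ (x * y) ^ 2 := by
      have : x ^ 2 ≤ x * y := by nlinarith
      gcongr
    nlinarith
  refine ⟨x, y, hx0, hxy, ?_, ?_, ?_, ?_, ?_⟩
  · nlinarith [mul_nonneg hx0 hy0]
  · rw [show ((nf k σ).act u1 u2 v1 v2).a = k * (v1 * (u1 ^ 2 + σ * v1 ^ 2)) by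
      simp only [nf, Cub.act]; ring]
    rw [abs_mul, abs_mul]
    calc |k| * (|v1| * |u1 ^ 2 + σ * v1 ^ 2|) ≤ |k| * (x * x ^ 2) := by
          have := hform u1 v1
          rw [← hx2] at this
          gcongr
      _ = _ := by ring
  · rw [show ((nf k σ).act u1 u2 v1 v2).b =
        k * (u1 * u1 * v2 + 2 * (u1 * u2 * v1) + 3 * (σ * (v1 * v1 * v2))) by
      simp only [nf, Cub.act]; ring]
    rw [abs_mul]
    have t1 : |u1 * u1 * v2| ≤ x * x * y := by rw [abs_mul, abs_mul]; gcongr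
    have t2 : |u1 * u2 * v1| ≤ x * y * x := by rw [abs_mul, abs_mul]; gcongr
    have t3 : |σ * (v1 * v1 * v2)| ≤ x * x * y := by
      rw [abs_mul, hσ1, one_mul, abs_mul, abs_mul]; gcongr
    have t : |u1 * u1 * v2 + 2 * (u1 * u2 * v1) + 3 * (σ * (v1 * v1 * v2))| ≤ 6 * (x ^ 2 * y) := by
      rw [abs_le] at *
      constructor <;> linarith
    have := mul_le_mul_of_nonneg_left t (abs_nonneg k)
    linarith
  · rw [show ((nf k σ).act u1 u2 v1 v2).c =
        k * (u2 * u2 * v1 + 2 * (u1 * u2 * v2) + 3 * (σ * (v1 * v2 * v2))) by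
      simp only [nf, Cub.act]; ring]
    rw [abs_mul]
    have t1 : |u2 * u2 * v1| ≤ y * y * x := by rw [abs_mul, abs_mul]; gcongr
    have t2 : |u1 * u2 * v2| ≤ x * y * y := by rw [abs_mul, abs_mul]; gcongr
    have t3 : |σ * (v1 * v2 * v2)| ≤ x * y * y := by
      rw [abs_mul, hσ1, one_mul, abs_mul, abs_mul]; gcongr
    have t : |u2 * u2 * v1 + 2 * (u1 * u2 * v2) + 3 * (σ * (v1 * v2 * v2))| ≤ 6 * (x * y ^ 2) := by
      rw [abs_le] at *
      constructor <;> linarith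
    have := mul_le_mul_of_nonneg_left t (abs_nonneg k)
    linarith
  · rw [show ((nf k σ).act u1 u2 v1 v2).d = k * (v2 * (u2 ^ 2 + σ * v2 ^ 2)) by
      simp only [nf, Cub.act]; ring]
    rw [abs_mul, abs_mul]
    calc |k| * (|v2| * |u2 ^ 2 + σ * v2 ^ 2|) ≤ |k| * (y * y ^ 2) := by
          have := hform u2 v2
          rw [← hy2] at this
          gcongr
      _ = _ := by ring

theorem bounds_a (k x y a b c d : ℝ) (hk : 1 / 2 ≤ k) (hx : 0 ≤ x) (hxy : x ≤ y)
    (hp : x * y ≤ 6 / 5) (ha : |a| ≤ k * x ^ 3) (hb : |b| ≤ 6 * k * (x ^ 2 * y))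
    (hc : |c| ≤ 6 * k * (x * y ^ 2)) (hd : |d| ≤ k * y ^ 3) :
    |a| ≤ 72 * k ^ 2 ∧ |b| ≤ 8 * k ∧ |a| * |d| ≤ 72 * k ^ 2 ∧ |b| * |c| ≤ 72 * k ^ 2 ∧
      (1 ≤ |a| → |c| ≤ 72 * k ^ 2) := by
  have hk0 : 0 < k := by linarith
  have hy : 0 ≤ y := hx.trans hxy
  have hx1 : x ≤ 11 / 10 := by nlinarith
  have hp0 : 0 ≤ x * y := mul_nonneg hx hy
  have hp3 : (x * y) ^ 3 ≤ (6 / 5) ^ 3 := by gcongr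
  refine ⟨?_, ?_, ?_, ?_, ?_⟩
  · have : x ^ 3 ≤ (11 / 10) ^ 3 := by gcongr
    nlinarith
  · have : x ^ 2 * y ≤ 132 / 100 := by
      have : x * (x * y) ≤ 11 / 10 * (6 / 5) := by gcongr
      nlinarith
    nlinarith
  · have : |a| * |d| ≤ (k * x ^ 3) * (k * y ^ 3) := by gcongr
    have e : (k * x ^ 3) * (k * y ^ 3) = k ^ 2 * (x * y) ^ 3 := by ring
    rw [e] at this
    nlinarith [sq_nonneg k]
  · have : |b| * |c| ≤ (6 * k * (x ^ 2 * y)) * (6 * k * (x * y ^ 2)) := by gcongr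
    have e : (6 * k * (x ^ 2 * y)) * (6 * k * (x * y ^ 2)) = 36 * (k ^ 2 * (x * y) ^ 3) := by ring
    rw [e] at this
    nlinarith [sq_nonneg k]
  · intro h1
    have hkx : 1 ≤ k * x ^ 3 := h1.trans ha
    have hyk : y ≤ 12 / 5 * k := by
      rcases le_total 1 x with h | h
      · nlinarith
      · have hx3 : x ^ 3 ≤ x := by
          have := pow_le_one₀ (n := 2) hx h
          nlinarith
        have : 1 ≤ k * x := hkx.trans (by gcongr)
        nlinarith
    have h3 : x * y ^ 2 ≤ 6 / 5 * (12 / 5 * k) := by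
      have : (x * y) * y ≤ 6 / 5 * (12 / 5 * k) := by gcongr
      nlinarith
    have h4 : 6 * k * (x * y ^ 2) ≤ 6 * k * (6 / 5 * (12 / 5 * k)) := by gcongr
    nlinarith

theorem balanced (b c : ℤ) (hb : b ≠ 0) : ∃ n : ℤ, |c + 2 * b * n| ≤ |b| := by
  have hpos : 0 < 2 * |b| := by positivity
  have h1 := Int.emod_nonneg (c + |b|) hpos.ne'
  have h2 := Int.emod_lt_of_pos (c + |b|) hpos
  have h3 := Int.mul_ediv_add_emod (c + |b|) (2 * |b|)
  set Q := (c + |b|) / (2 * |b|)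
  set E := (c + |b|) % (2 * |b|)
  rcases abs_choice b with h | h
  · refine ⟨-Q, ?_⟩
    have : c + 2 * b * -Q = E - |b| := by
      have : 2 * b * Q = 2 * |b| * Q := by rw [h]
      linarith
    rw [this, abs_le]; constructor <;> linarith
  · refine ⟨Q, ?_⟩
    have : c + 2 * b * Q = E - |b| := by
      have : 2 * b * Q = - (2 * |b| * Q) := by rw [h]; ring
      linarith
    rw [this, abs_le]; constructor <;> linarith

theorem exists_rep (F : Cub ℤ) (X N : ℕ) (hF : F.disc ≠ 0) (hX : |F.disc| ≤ X)
    (hN : 1296 * X ≤ N ^ 2) :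
    ∃ p q r s : ℤ, p * s - q * r = 1 ∧
      (Rep1 N (F.act p q r s) ∨ Rep2 (1024 * X) (F.act p q r s)) := by
  obtain ⟨k', σ, u1, u2, v1, v2, hdec⟩ := exists_dec F.toReal (by
    rw [toReal_disc]; exact_mod_cast hF)
  obtain ⟨p, q, r, s, hdet, hr1, hr2⟩ := reduction u1 u2 v1 v2 hdec.2.2.1
  have hdetR : (p : ℝ) * s - q * r = 1 := by exact_mod_cast hdet
  have hdec2 := hdec.act hdetR
  rw [← toReal_act] at hdec2
  obtain ⟨x, y, hx, hxy, hp, ha, hb, hc, hd⟩ := coef_bounds _ _ _ _ _ _ _ hdec2 hr1 hr2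
  have hD := hdec.disc
  rw [toReal_disc] at hD
  set k := |k'| with hkdef
  have hk4 : k' ^ 4 = k ^ 4 := by rw [hkdef, (by norm_num : Even 4).pow_abs]
  rw [hk4] at hD
  have hk0 : 0 ≤ k := abs_nonneg _
  have hk : 1 / 2 ≤ k := by
    by_contra hcon
    push Not at hcon
    have h1 : k ^ 4 < (1 / 2) ^ 4 := by gcongr
    have h2 : (1 : ℝ) ≤ |(F.disc : ℝ)| := by exact_mod_cast Int.one_le_abs hF
    norm_num at h1
    linarith
  have hXR : 4 * k ^ 4 ≤ X := by rw [← hD]; exact_mod_cast hX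
  have hNR : 1296 * (X : ℝ) ≤ (N : ℝ) ^ 2 := by exact_mod_cast hN
  have hkN : 72 * k ^ 2 ≤ N := by
    apply le_of_sq_le_sq _ (Nat.cast_nonneg N)
    nlinarith
  obtain ⟨c1, c2, c3, c4, c5⟩ := bounds_a k x y _ _ _ _ hk hx hxy hp ha hb hc hd
  have hdiscG : (F.act p q r s).disc = F.disc := by rw [disc_act, hdet]; ring
  set G := F.act p q r s with hG
  simp only [toReal] at c1 c2 c3 c4 c5
  by_cases ha0 : G.a = 0
  · have hb0 : G.b ≠ 0 := by
      intro hb0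
      apply hF
      rw [← hdiscG, Cub.disc, ha0, hb0]; ring
    obtain ⟨n, hn⟩ := balanced G.b G.c hb0
    refine ⟨p, p * n + q, r, r * n + s, by linear_combination hdet, Or.inr ?_⟩
    have e : F.act p (p * n + q) r (r * n + s) = G.act 1 n 0 1 := by
      rw [hG, act_act]; congr 1 <;> ring
    rw [e]
    have hdisc' : (G.act 1 n 0 1).disc = F.disc := by
      rw [disc_act, hdiscG]; ring
    have ea : (G.act 1 n 0 1).a = 0 := by simp [Cub.act, ha0]
    have eb : (G.act 1 n 0 1).b = G.b := by simp [Cub.act, ha0]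
    have ec : (G.act 1 n 0 1).c = G.c + 2 * G.b * n := by simp [Cub.act, ha0]; ring
    set K := G.act 1 n 0 1
    have hcb : |K.c| ≤ |K.b| := by rw [ec, eb]; exact hn
    have hb4 : K.b ^ 4 ≤ 1024 * X := by
      rw [eb]
      have h1 : |(G.b : ℝ)| ^ 4 ≤ (8 * k) ^ 4 := by gcongr
      rw [(by norm_num : Even 4).pow_abs] at h1
      have h2 : (G.b : ℝ) ^ 4 ≤ 1024 * X := by nlinarith
      exact_mod_cast h2
    have hdd : K.disc = K.b ^ 2 * K.c ^ 2 - 4 * (K.b ^ 3 * K.d) := by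
      rw [Cub.disc, ea]; ring
    have h2 : K.c ^ 2 ≤ K.b ^ 2 := sq_le_sq.mpr hcb
    have h3 : K.b ^ 2 * K.c ^ 2 ≤ 1024 * X := by nlinarith [sq_nonneg K.b]
    have h4 := abs_le.mp hX
    rw [← hdisc', hdd] at h4
    refine ⟨ea, by rw [eb]; exact hb0, hcb, by exact_mod_cast hb4, ?_⟩
    push_cast
    rw [abs_le]
    have h5 : 0 ≤ K.b ^ 2 * K.c ^ 2 := by positivity
    constructor <;> linarith
  · refine ⟨p, q, r, s, hdet, Or.inl ?_⟩
    have ha1 : (1 : ℝ) ≤ |(G.a : ℝ)| := by exact_mod_cast Int.one_le_abs ha0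
    have hk8 : 8 * k ≤ 72 * k ^ 2 := by nlinarith
    have nat : ∀ z : ℤ, |(z : ℝ)| ≤ N → z.natAbs ≤ N := by
      intro z hz
      have : |z| ≤ N := by exact_mod_cast hz
      zify; exact this
    have nat2 : ∀ z w : ℤ, |(z : ℝ)| * |(w : ℝ)| ≤ N → z.natAbs * w.natAbs ≤ N := by
      intro z w hz
      have : |z| * |w| ≤ N := by exact_mod_cast hz
      zify; exact this
    have hdN : |(G.d : ℝ)| ≤ N :=
      (le_mul_of_one_le_left (abs_nonneg _) ha1).trans (c3.trans hkN)
    exact ⟨⟨nat _ (c1.trans hkN), nat _ hdN, nat2 _ _ (c3.trans hkN)⟩,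
      ⟨nat _ ((c2.trans hk8).trans hkN), nat _ ((c5 ha1).trans hkN), nat2 _ _ (c4.trans hkN)⟩⟩


theorem fiber_card (G : Cub ℤ) (H Z : ℝ) (j J : ℕ) (hH : 1 ≤ H) (hJ : 8 * H ≤ 2 ^ J)
    (hZ0 : 0 ≤ Z) (hZ : 4 * H ^ 4 ≤ 2 ^ j * Z ^ 12) (hG : 2 ^ j ≤ G.disc.natAbs)
    (S : Finset ((ℤ × ℤ) × (ℤ × ℤ)))
    (hS : ∀ g ∈ S, g.1.1 * g.2.2 - g.2.1 * g.1.2 = 1 ∧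
      (G.act g.1.1 g.2.1 g.1.2 g.2.2).ht H) :
    (S.card : ℝ) ≤ 10 * ((J + 1) * (12 * (5 + 16 * Z ^ 2))) := by
  have h1 : (2 : ℝ) ^ j ≤ |(G.disc : ℝ)| := by
    have : ((2 ^ j : ℕ) : ℝ) ≤ (G.disc.natAbs : ℝ) := by exact_mod_cast hG
    rw [Nat.cast_natAbs] at this
    push_cast at this
    exact this
  have h2 : (0 : ℝ) < 2 ^ j := by positivity
  have h3 : 0 < |(G.disc : ℝ)| / 4 := by linarith
  obtain ⟨k, hk, hk4⟩ : ∃ k : ℝ, 0 < k ∧ k ^ 4 = |(G.disc : ℝ)| / 4 := by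
    refine ⟨√√(|(G.disc : ℝ)| / 4), by positivity, ?_⟩
    rw [show (4 : ℕ) = 2 * 2 from rfl, pow_mul, Real.sq_sqrt (by positivity),
      Real.sq_sqrt h3.le]
  refine orbit_card G H Z k J hH hk (by rw [hk4]; ring) hZ0 ?_ hJ S hS
  rw [div_le_iff₀ hk]
  refine le_of_pow_le_pow_left₀ (n := 4) (by norm_num) (by positivity) ?_
  rw [mul_pow, hk4, ← pow_mul]
  have : 2 ^ j * Z ^ 12 ≤ |(G.disc : ℝ)| * Z ^ 12 :=
    mul_le_mul_of_nonneg_right h1 (by positivity)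
  norm_num
  linarith

theorem dyadic_card (H Z : ℝ) (j J N : ℕ) (hH : 1 ≤ H) (hJ : 8 * H ≤ 2 ^ J)
    (hZ0 : 0 ≤ Z) (hZ : 4 * H ^ 4 ≤ 2 ^ j * Z ^ 12) (hN1 : 1 ≤ N)
    (hN : 1296 * 2 ^ (j + 1) ≤ N ^ 2) (S : Finset (Cub ℤ))
    (hS : ∀ F ∈ S, F.ht H ∧ 2 ^ j ≤ F.disc.natAbs ∧ F.disc.natAbs < 2 ^ (j + 1)) :
    (S.card : ℝ) ≤ ((16 * N * (1 + Real.log N)) ^ 2 +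
      16 * (4 * (1024 * 2 ^ (j + 1)) : ℕ) *
        (1 + Real.log (4 * (1024 * 2 ^ (j + 1)) : ℕ))) *
      (10 * ((J + 1) * (12 * (5 + 16 * Z ^ 2)))) := by
  classical
  have hex : ∀ F ∈ S, ∃ p q r s : ℤ, p * s - q * r = 1 ∧
      (Rep1 N (F.act p q r s) ∨ Rep2 (1024 * 2 ^ (j + 1)) (F.act p q r s)) := by
    intro F hF
    obtain ⟨_, h2, h3⟩ := hS F hF
    have h4 : (0 : ℕ) < 2 ^ j := by positivity
    refine exists_rep F (2 ^ (j + 1)) N (by intro h; simp [h] at h2) ?_ hN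
    rw [Int.abs_eq_natAbs]
    exact_mod_cast h3.le
  choose! p q r s hdet hrep using hex
  set f : Cub ℤ → Cub ℤ := fun F => F.act (p F) (q F) (r F) (s F) with hf
  have hfib : ∀ G ∈ S.image f, ((S.filter (fun F => f F = G)).card : ℝ) ≤
      10 * ((J + 1) * (12 * (5 + 16 * Z ^ 2))) := by
    intro G hG
    obtain ⟨F0, hF0, rfl⟩ := Finset.mem_image.1 hG
    set φ : Cub ℤ → (ℤ × ℤ) × (ℤ × ℤ) := fun F => ((s F, -r F), (-q F, p F)) with hφ
    have hinv : ∀ F ∈ S, (f F).act (s F) (-q F) (-r F) (p F) = F := by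
      intro F hF
      exact act_inv F _ _ _ _ (hdet F hF)
    have hinj : Set.InjOn φ (S.filter (fun F => f F = f F0)) := by
      intro A hA B hB hAB
      simp only [Finset.coe_filter, Set.mem_ofPred_eq] at hA hB
      simp only [hφ, Prod.mk.injEq, neg_inj] at hAB
      obtain ⟨⟨e1, e2⟩, e3, e4⟩ := hAB
      rw [← hinv A hA.1, ← hinv B hB.1, hA.2, hB.2, e1, e2, e3, e4]
    rw [← Finset.card_image_of_injOn hinj]
    have hd : (f F0).disc = F0.disc := by
      simp only [hf, disc_act, hdet F0 hF0]; ring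
    refine fiber_card (f F0) H Z j J hH hJ hZ0 hZ (by rw [hd]; exact (hS F0 hF0).2.1) _ ?_
    intro g hg
    obtain ⟨F, hF, rfl⟩ := Finset.mem_image.1 hg
    rw [Finset.mem_filter] at hF
    refine ⟨?_, ?_⟩
    · simp only [hφ]
      linarith [hdet F hF.1]
    · simp only [hφ]
      rw [← hF.2, hinv F hF.1]
      exact (hS F hF.1).1
  have hcard : ((S.image f).card : ℝ) ≤ (16 * N * (1 + Real.log N)) ^ 2 +
      16 * (4 * (1024 * 2 ^ (j + 1)) : ℕ) *
        (1 + Real.log (4 * (1024 * 2 ^ (j + 1)) : ℕ)) := by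
    have hsub : S.image f ⊆ (S.image f).filter (fun G => Rep1 N G) ∪
        (S.image f).filter (fun G => Rep2 (1024 * 2 ^ (j + 1)) G) := by
      intro G hG
      obtain ⟨F, hF, rfl⟩ := Finset.mem_image.1 hG
      rcases hrep F hF with h | h
      · exact Finset.mem_union_left _ (Finset.mem_filter.2 ⟨hG, h⟩)
      · exact Finset.mem_union_right _ (Finset.mem_filter.2 ⟨hG, h⟩)
    have h1 := (Finset.card_le_card hsub).trans (Finset.card_union_le _ _)
    have h2 := rep1_card N hN1 ((S.image f).filter (fun G => Rep1 N G))
      (fun G hG => (Finset.mem_filter.1 hG).2)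
    have h3 := rep2_card (1024 * 2 ^ (j + 1)) (Nat.one_le_iff_ne_zero.2 (by positivity))
      ((S.image f).filter (fun G => Rep2 (1024 * 2 ^ (j + 1)) G))
      (fun G hG => (Finset.mem_filter.1 hG).2)
    have h4 := (Nat.cast_le (α := ℝ)).2 h1
    rw [Nat.cast_add] at h4
    linarith
  rw [Finset.card_eq_sum_card_image f S, Nat.cast_sum]
  refine (Finset.sum_le_card_nsmul _ _ _ hfib).trans ?_
  rw [nsmul_eq_mul]
  exact mul_le_mul_of_nonneg_right hcard (by positivity)


theorem nat_le_of_two_pow (n m : ℕ) (a x : ℝ) (hx : 1 ≤ x) (ha : 0 ≤ a)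
    (h : (2 : ℝ) ^ n ≤ 2 ^ m * x ^ a) : (n : ℝ) ≤ m + 3 / 2 * a * Real.log x := by
  have hx0 : 0 < x := by linarith
  have h1 := Real.log_le_log (by positivity) h
  rw [Real.log_pow, Real.log_mul (by positivity) (by positivity), Real.log_pow,
    Real.log_rpow hx0] at h1
  have h2 := Real.log_two_gt_d9
  have h3 : 0 ≤ a * Real.log x := mul_nonneg ha (Real.log_nonneg hx)
  have h4 : 0 < Real.log 2 := by linarith
  have h5 : (n : ℝ) * Real.log 2 ≤ (m + 3 / 2 * a * Real.log x) * Real.log 2 := by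
    nlinarith
  exact le_of_mul_le_mul_right h5 h4

theorem dyadic_bound (H D : ℝ) (j : ℕ) (hH : 1 ≤ H) (hj1 : (2 : ℝ) ^ j ≤ 54 * H ^ 4)
    (hj2 : (2 : ℝ) ^ j ≤ D) (S : Finset (Cub ℤ))
    (hS : ∀ F ∈ S, F.ht H ∧ 2 ^ j ≤ F.disc.natAbs ∧ F.disc.natAbs < 2 ^ (j + 1)) :
    (S.card : ℝ) ≤ 20000000000000 * (1 + Real.log H) ^ 3 *
      (H ^ ((2 : ℝ) / 3) * D ^ ((5 : ℝ) / 6)) := by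
  have hH0 : 0 < H := by linarith
  have hlH := Real.log_nonneg hH
  set L := 1 + Real.log H with hL
  have hL1 : 1 ≤ L := by linarith
  set y : ℝ := 2 ^ j with hy
  have hy1 : 1 ≤ y := one_le_pow₀ (by norm_num)
  have hy0 : 0 < y := by linarith
  -- the parameter Z
  set W : ℝ := 4 * H ^ 4 / y with hW
  have hW0 : 0 < W := by positivity
  set Z : ℝ := W ^ ((1 : ℝ) / 12) with hZdef
  have hZ0 : 0 < Z := Real.rpow_pos_of_pos hW0 _
  have hZ12 : Z ^ 12 = W := by
    rw [hZdef, ← Real.rpow_natCast, ← Real.rpow_mul hW0.le]; norm_num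
  have hZ : 4 * H ^ 4 ≤ y * Z ^ 12 := by
    rw [hZ12, hW, mul_div_cancel₀ _ hy0.ne']
  have hZ2 : 1 / 2 ≤ Z ^ 2 := by
    refine le_of_pow_le_pow_left₀ (n := 6) (by norm_num) (by positivity) ?_
    rw [← pow_mul]
    norm_num
    rw [hZ12, hW, le_div_iff₀ hy0]
    have : 0 < H ^ 4 := by positivity
    linarith
  have hyZ : y * Z ^ 2 ≤ 2 * (H ^ ((2 : ℝ) / 3) * D ^ ((5 : ℝ) / 6)) := by
    have e1 : y * Z ^ 2 ≤ 2 * (H ^ ((2 : ℝ) / 3) * y ^ ((5 : ℝ) / 6)) := by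
      refine le_of_pow_le_pow_left₀ (n := 6) (by norm_num) (by positivity) ?_
      have a1 : (H ^ ((2 : ℝ) / 3)) ^ 6 = H ^ 4 := by
        rw [← Real.rpow_natCast, ← Real.rpow_mul hH0.le, ← Real.rpow_natCast]; norm_num
      have a2 : (y ^ ((5 : ℝ) / 6)) ^ 6 = y ^ 5 := by
        rw [← Real.rpow_natCast, ← Real.rpow_mul hy0.le, ← Real.rpow_natCast]; norm_num
      rw [mul_pow, mul_pow, mul_pow, a1, a2, show (Z ^ 2) ^ 6 = Z ^ 12 by ring, hZ12, hW]
      have : y ^ 6 * (4 * H ^ 4 / y) = 4 * (H ^ 4 * y ^ 5) := by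
        field_simp
      rw [this]
      have : 0 < H ^ 4 * y ^ 5 := by positivity
      linarith
    have e2 : y ^ ((5 : ℝ) / 6) ≤ D ^ ((5 : ℝ) / 6) :=
      Real.rpow_le_rpow hy0.le hj2 (by norm_num)
    refine e1.trans ?_
    have := Real.rpow_pos_of_pos hH0 ((2 : ℝ) / 3)
    gcongr
  -- the parameter J
  obtain ⟨n, hn1, hn2⟩ := exists_nat_pow_near (x := 8 * H) (y := 2) (by linarith) (by norm_num)
  have hn : (n : ℝ) ≤ 3 + 3 / 2 * Real.log H := by
    have := nat_le_of_two_pow n 3 1 H hH (by norm_num) (by rw [Real.rpow_one]; linarith)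
    push_cast at this
    linarith
  -- the parameter N
  set X : ℕ := 2 ^ (j + 1) with hX
  have hXy : (X : ℝ) = 2 * y := by rw [hX, hy]; push_cast; ring
  have hX1 : 1 ≤ X := Nat.one_le_two_pow
  have hsq1 : 1 ≤ Nat.sqrt X := Nat.le_sqrt.2 (by simpa using hX1)
  have hsq2 : Nat.sqrt X * Nat.sqrt X ≤ X := Nat.sqrt_le X
  have hsq3 : X < (Nat.sqrt X + 1) * (Nat.sqrt X + 1) := Nat.lt_succ_sqrt X
  set N : ℕ := 36 * (Nat.sqrt X + 1) with hN
  have hN2 : 1296 * X ≤ N ^ 2 := by rw [hN]; nlinarith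
  have hN3 : N ^ 2 ≤ 5184 * X := by rw [hN]; nlinarith
  have hN1 : 1 ≤ N := by omega
  have hNX : N ≤ 4 * (1024 * X) := by
    have := Nat.sqrt_le_self X
    omega
  have key := dyadic_card H Z j (n + 1) N hH hn2.le hZ0.le hZ hN1 hN2 S hS
  rw [← hX] at key
  set Λ := 1 + Real.log ((4 * (1024 * X) : ℕ) : ℝ) with hΛ
  have hM : ((4 * (1024 * X) : ℕ) : ℝ) = 8192 * y := by push_cast; rw [hXy]; ring
  have hN1' : (1 : ℝ) ≤ N := by exact_mod_cast hN1
  have hlN0 : 0 ≤ Real.log N := Real.log_nonneg hN1'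
  have hlN : 1 + Real.log N ≤ Λ := by
    have : Real.log N ≤ Real.log ((4 * (1024 * X) : ℕ) : ℝ) :=
      Real.log_le_log (by linarith) (by exact_mod_cast hNX)
    linarith
  have hΛL : Λ ≤ 15 * L := by
    have h1 : Real.log (8192 * y) ≤ Real.log (2 ^ 19 * H ^ 4) := by
      apply Real.log_le_log (by positivity)
      have : 0 < H ^ 4 := by positivity
      norm_num
      linarith
    have h0 : Real.log (2 ^ 19 * H ^ 4) = 19 * Real.log 2 + 4 * Real.log H := by
      rw [Real.log_mul (by positivity) (by positivity), Real.log_pow, Real.log_pow]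
      push_cast
      ring
    rw [h0] at h1
    have h2 := Real.log_two_lt_d9
    rw [hΛ, hM]
    linarith
  have hN3' : (N : ℝ) ^ 2 ≤ 5184 * (2 * y) := by rw [← hXy]; exact_mod_cast hN3
  have b1 : (16 * N * (1 + Real.log N)) ^ 2 ≤ 256 * (5184 * (2 * y)) * (15 * L) ^ 2 := by
    have : (16 * N * (1 + Real.log N)) ^ 2 = 256 * (N : ℝ) ^ 2 * (1 + Real.log N) ^ 2 := by
      ring
    rw [this]
    have := hlN.trans hΛL
    gcongr
  have b2 : 16 * ((4 * (1024 * X) : ℕ) : ℝ) * Λ ≤ 16 * (8192 * y) * (15 * L ^ 2) := by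
    rw [hM]
    have : Λ ≤ 15 * L ^ 2 := by nlinarith
    gcongr
  have b3 : (16 * N * (1 + Real.log N)) ^ 2 + 16 * ((4 * (1024 * X) : ℕ) : ℝ) * Λ ≤
      600000000 * (y * L ^ 2) := by
    have : 0 < y * L ^ 2 := by positivity
    linarith
  have b4 : 10 * ((((n + 1 : ℕ) : ℝ) + 1) * (12 * (5 + 16 * Z ^ 2))) ≤
      10 * ((5 * L) * (12 * (26 * Z ^ 2))) := by
    have : ((n + 1 : ℕ) : ℝ) + 1 ≤ 5 * L := by push_cast; linarith
    have : 5 + 16 * Z ^ 2 ≤ 26 * Z ^ 2 := by linarith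
    gcongr
  calc (S.card : ℝ) ≤ _ := key
    _ ≤ (600000000 * (y * L ^ 2)) * (10 * ((5 * L) * (12 * (26 * Z ^ 2)))) :=
        mul_le_mul b3 b4 (by positivity) (by positivity)
    _ = 9360000000000 * L ^ 3 * (y * Z ^ 2) := by ring
    _ ≤ 9360000000000 * L ^ 3 * (2 * (H ^ ((2 : ℝ) / 3) * D ^ ((5 : ℝ) / 6))) := by
        gcongr
    _ ≤ _ := by
        have h1 : 0 < D := by linarith
        have : 0 ≤ L ^ 3 * (H ^ ((2 : ℝ) / 3) * D ^ ((5 : ℝ) / 6)) := by positivity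
        linarith

theorem total_bound (H D : ℝ) (hH : 1 ≤ H) (S : Finset (Cub ℤ))
    (hS : ∀ F ∈ S, F.ht H ∧ F.disc ≠ 0 ∧ |(F.disc : ℝ)| ≤ D) (hD : 1 ≤ D) :
    (S.card : ℝ) ≤ 140000000000000 * (1 + Real.log H) ^ 4 *
      (H ^ ((2 : ℝ) / 3) * D ^ ((5 : ℝ) / 6)) := by
  classical
  have hlH := Real.log_nonneg hH
  have hH4 : 1 ≤ H ^ 4 := one_le_pow₀ hH
  obtain ⟨n, hn1, hn2⟩ := exists_nat_pow_near (x := 54 * H ^ 4) (y := 2) (by linarith)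
    (by norm_num)
  have hn : (n : ℝ) ≤ 6 + 6 * Real.log H := by
    have := nat_le_of_two_pow n 6 4 H hH (by norm_num) (by
      rw [show (4 : ℝ) = ((4 : ℕ) : ℝ) by norm_num, Real.rpow_natCast]; linarith)
    push_cast at this
    linarith
  set f : Cub ℤ → ℕ := fun F => Nat.log 2 F.disc.natAbs with hf
  have hpos : ∀ F ∈ S, 2 ^ f F ≤ F.disc.natAbs ∧ F.disc.natAbs < 2 ^ (f F + 1) := by
    intro F hF
    have h0 : F.disc.natAbs ≠ 0 := by simpa using (hS F hF).2.1
    exact ⟨Nat.pow_log_le_self 2 h0, Nat.lt_pow_succ_log_self (by norm_num) _⟩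
  have hreal : ∀ F ∈ S, (2 : ℝ) ^ f F ≤ |(F.disc : ℝ)| := by
    intro F hF
    have : ((2 ^ f F : ℕ) : ℝ) ≤ (F.disc.natAbs : ℝ) := by exact_mod_cast (hpos F hF).1
    rw [Nat.cast_natAbs] at this
    push_cast at this
    exact this
  have hmap : ∀ F ∈ S, f F ∈ Finset.range (n + 1) := by
    intro F hF
    rw [Finset.mem_range]
    have h1 := ((hreal F hF).trans (disc_le F H (hS F hF).1)).trans_lt hn2
    exact (pow_lt_pow_iff_right₀ (by norm_num : (1 : ℝ) < 2)).1 h1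
  set B : ℝ := 20000000000000 * (1 + Real.log H) ^ 3 *
      (H ^ ((2 : ℝ) / 3) * D ^ ((5 : ℝ) / 6)) with hB
  have hB0 : 0 ≤ B := by positivity
  rw [Finset.card_eq_sum_card_fiberwise hmap, Nat.cast_sum]
  have hfib : ∀ j ∈ Finset.range (n + 1), ((S.filter (fun F => f F = j)).card : ℝ) ≤ B := by
    intro j _
    rcases Finset.eq_empty_or_nonempty (S.filter (fun F => f F = j)) with h | ⟨F, hF⟩
    · rw [h]; simpa using hB0
    · rw [Finset.mem_filter] at hF
      obtain ⟨hF, rfl⟩ := hF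
      refine dyadic_bound H D (f F) hH ((hreal F hF).trans (disc_le F H (hS F hF).1))
        ((hreal F hF).trans (hS F hF).2.2) _ ?_
      intro A hA
      rw [Finset.mem_filter] at hA
      have := hpos A hA.1
      rw [hA.2] at this
      exact ⟨(hS A hA.1).1, this⟩
  refine (Finset.sum_le_card_nsmul _ _ _ hfib).trans ?_
  rw [nsmul_eq_mul, Finset.card_range]
  calc ((n + 1 : ℕ) : ℝ) * B ≤ (7 * (1 + Real.log H)) * B := by
        refine mul_le_mul_of_nonneg_right ?_ hB0
        push_cast; linarith
    _ = _ := by rw [hB]; ring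

theorem log_pow_bound (ε : ℝ) (hε : 0 < ε) (H : ℝ) (hH : 1 ≤ H) :
    (1 + Real.log H) ^ 4 ≤ (1 + 4 / ε) ^ 4 * H ^ ε := by
  have hH0 : 0 < H := by linarith
  have h1 := Real.log_le_rpow_div hH0.le (show 0 < ε / 4 by positivity)
  have h2 : 1 ≤ H ^ (ε / 4) := Real.one_le_rpow hH (by positivity)
  have h3 : 1 + Real.log H ≤ (1 + 4 / ε) * H ^ (ε / 4) := by
    have : H ^ (ε / 4) / (ε / 4) = 4 / ε * H ^ (ε / 4) := by field_simp
    rw [this] at h1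
    linarith
  have h4 : (H ^ (ε / 4)) ^ 4 = H ^ ε := by
    rw [← Real.rpow_natCast, ← Real.rpow_mul hH0.le]
    congr 1
    push_cast
    ring
  rw [← h4, ← mul_pow]
  exact pow_le_pow_left₀ (by linarith [Real.log_nonneg hH]) h3 4


/-- For every `ε > 0` there is `c = c(ε) > 0` such that for all `H, D ≥ 1` the number of
cubic integer polynomials of naive height at most `H` and nonzero discriminant of absolute
value at most `D` is at most `c·H^{2/3+ε}·D^{5/6}`. -/
theorem stmt5 (ε : ℝ) (hε : 0 < ε) :
    ∃ c : ℝ, 0 < c ∧ ∀ H D : ℝ, 1 ≤ H → 1 ≤ D →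
      (({v : Fin 4 → ℤ | v 3 ≠ 0 ∧ (∀ i, |(v i : ℝ)| ≤ H) ∧
          cubicDisc (v 0) (v 1) (v 2) (v 3) ≠ 0 ∧
          |(cubicDisc (v 0) (v 1) (v 2) (v 3) : ℝ)| ≤ D}).ncard : ℝ) ≤
        c * H ^ ((2 : ℝ) / 3 + ε) * D ^ ((5 : ℝ) / 6) := by
  classical
  refine ⟨140000000000000 * (1 + 4 / ε) ^ 4, by positivity, ?_⟩
  intro H D hH hD
  set T : Set (Fin 4 → ℤ) := {v : Fin 4 → ℤ | v 3 ≠ 0 ∧ (∀ i, |(v i : ℝ)| ≤ H) ∧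
          cubicDisc (v 0) (v 1) (v 2) (v 3) ≠ 0 ∧
          |(cubicDisc (v 0) (v 1) (v 2) (v 3) : ℝ)| ≤ D} with hT
  have hfin : T.Finite := by
    refine Set.Finite.subset
      (Fintype.piFinset (fun _ : Fin 4 => Finset.Icc (-⌊H⌋) ⌊H⌋)).finite_toSet ?_
    intro v hv
    rw [Finset.mem_coe, Fintype.mem_piFinset]
    intro i
    have h := hv.2.1 i
    have h2 : |v i| ≤ ⌊H⌋ := Int.le_floor.2 (by push_cast; exact h)
    rw [Finset.mem_Icc]
    exact abs_le.1 h2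
  rw [Set.ncard_eq_toFinset_card T hfin]
  set φ : (Fin 4 → ℤ) → Cub ℤ := fun v => ⟨v 3, v 2, v 1, v 0⟩ with hφ
  have hinj : Function.Injective φ := by
    intro v w h
    simp only [hφ, Cub.mk.injEq] at h
    obtain ⟨h3, h2, h1, h0⟩ := h
    funext i
    fin_cases i
    · exact h0
    · exact h1
    · exact h2
    · exact h3
  rw [← Finset.card_image_of_injective _ hinj]
  have hH0 : 0 < H := by linarith
  refine (total_bound H D hH _ ?_ hD).trans ?_
  · intro F hF
    obtain ⟨v, hv, rfl⟩ := Finset.mem_image.1 hF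
    rw [Set.Finite.mem_toFinset] at hv
    exact ⟨⟨hv.2.1 3, hv.2.1 2, hv.2.1 1, hv.2.1 0⟩, hv.2.2.1, hv.2.2.2⟩
  · rw [Real.rpow_add hH0]
    have h1 := log_pow_bound ε hε H hH
    have h2 : 0 ≤ H ^ ((2 : ℝ) / 3) * D ^ ((5 : ℝ) / 6) := by positivity
    have h3 := mul_le_mul_of_nonneg_right h1 h2
    calc _ = 140000000000000 * ((1 + Real.log H) ^ 4 *
          (H ^ ((2 : ℝ) / 3) * D ^ ((5 : ℝ) / 6))) := by ring
      _ ≤ 140000000000000 * ((1 + 4 / ε) ^ 4 * H ^ ε *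
          (H ^ ((2 : ℝ) / 3) * D ^ ((5 : ℝ) / 6))) := by linarith
      _ = _ := by ring
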